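/- arXiv:2404.07350 — 2 statements merged into one kernel-verified Lean document; each statement's English description precedes it below -/
import Mathlib

section
/- Let 𝒢 = (𝒞, ℰ) be a finite simple graph and let (Γ_c)_{c∈𝒞} be countable sofic groups. Then the graph product of the groups (Γ_c)_{c∈𝒞} over 𝒢 is sofic. -/
open Filter MeasureTheory Matrix
open scoped BigOperators Classical

namespace GraphPaper

/-! ### Directed multigraphs (test digraphs) -/

/-- A directed multigraph with vertex type `V` and edge type `E`. -/
structure Digr (V E : Type*) where
  src : E → V
  tgt : E → V

namespace Digr

variable {V E : Type*} (D : Digr V E)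

/-- One-step (direction-agnostic) adjacency. -/
def Adj (v w : V) : Prop := ∃ e : E, D.src e = v ∧ D.tgt e = w

/-- The setoid of weakly connected components. -/
def compSetoid : Setoid V := Relation.EqvGen.setoid D.Adj

/-- The weakly connected components. -/
def Components : Type _ := Quotient D.compSetoid

/-- The number of weakly connected components. -/
noncomputable def ncomp : ℕ := Nat.card D.Components

/-- Weak connectedness. -/
def IsConnected : Prop := Nonempty V ∧ ∀ v w : V, D.compSetoid v w

/-- The digraph with one edge removed. -/
def erase (e₀ : E) : Digr V {e : E // e ≠ e₀} :=
  ⟨fun e => D.src e.1, fun e => D.tgt e.1⟩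

/-- `e₀` is a cut edge: removing it increases the number of weakly connected components. -/
def IsCutEdge (e₀ : E) : Prop := D.ncomp < (D.erase e₀).ncomp

/-- Two-edge-connectedness: weakly connected with no cut edge. -/
def IsTwoEdgeConnected : Prop := D.IsConnected ∧ ∀ e : E, ¬ D.IsCutEdge e

/-- A tree (as an undirected multigraph): connected, with no cycles and no parallel
edges; equivalently, connected and every edge is a cut edge. -/
def IsTree : Prop := D.IsConnected ∧ ∀ e : E, D.IsCutEdge e

/-- Two vertices are related iff they are joined by a path containing no cut edges;
the classes are the two-edge-connected components. -/
def tecSetoid : Setoid V :=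
  Relation.EqvGen.setoid (fun v w => ∃ e : E, ¬ D.IsCutEdge e ∧ D.src e = v ∧ D.tgt e = w)

/-- The degree of a two-edge-connected component in the forest `ℱ(D)`:
the number of cut edges incident to it. -/
noncomputable def tecDeg (b : Quotient D.tecSetoid) : ℕ :=
  Nat.card {e : E // D.IsCutEdge e ∧
    (Quotient.mk D.tecSetoid (D.src e) = b ∨ Quotient.mk D.tecSetoid (D.tgt e) = b)}

/-- `𝔣(D)`: the total number of leaves of the forest `ℱ(D)` of two-edge-connected
components, an isolated vertex counting as two leaves. -/
noncomputable def leafCount : ℕ :=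
  ∑ᶠ b : Quotient D.tecSetoid,
    (if D.tecDeg b = 0 then 2 else if D.tecDeg b = 1 then 1 else 0)

/-- The quotient digraph by a partition (setoid) of the vertices. -/
def quotient (s : Setoid V) : Digr (Quotient s) E :=
  ⟨fun e => Quotient.mk s (D.src e), fun e => Quotient.mk s (D.tgt e)⟩

/-- The subgraph retaining only the edges satisfying `p` (all vertices kept). -/
def restrict (p : E → Prop) : Digr V {e : E // p e} :=
  ⟨fun e => D.src e.1, fun e => D.tgt e.1⟩

/-- The trace of a test digraph with labels `A`. -/
noncomputable def tdTrace {ι : Type*} (A : E → Matrix ι ι ℂ) : ℂ :=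
  (1 / (Nat.card ι : ℂ) ^ D.ncomp) *
    ∑ᶠ i : V → ι, ∏ᶠ e : E, A e (i (D.tgt e)) (i (D.src e))

/-- The injective trace of a test digraph with labels `A`. -/
noncomputable def tdTraceInj {ι : Type*} (A : E → Matrix ι ι ℂ) : ℂ :=
  (1 / (Nat.card ι : ℂ) ^ D.ncomp) *
    ∑ᶠ i : V → ι,
      if Function.Injective i then ∏ᶠ e : E, A e (i (D.tgt e)) (i (D.src e)) else 0

end Digr

/-! ### Colored digraphs, partitions, and the associated auxiliary graphs -/

section Colored

variable {V E S C : Type*}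

/-- `ρ_s` : the partition of `V` into weakly connected components of the subgraph of `D`
retaining only edges whose color is not related to the string `s`. -/
def rhoSetoid (D : Digr V E) (χ : E → C) (rel : S → C → Prop) (s : S) : Setoid V :=
  Relation.EqvGen.setoid (fun v w => ∃ e : E, ¬ rel s (χ e) ∧ D.src e = v ∧ D.tgt e = w)

/-- `ω_{π,c} = ⋀_{s ∈ 𝒮_c} π_s`, the common refinement. -/
def omegaSetoid (rel : S → C → Prop) (π : S → Setoid V) (c : C) : Setoid V :=
  ⨅ s : {s : S // rel s c}, π s.1

/-- `T_{π,c} = (T|_c)/ω_{π,c}`. -/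
def Tpc (D : Digr V E) (χ : E → C) (rel : S → C → Prop) (π : S → Setoid V) (c : C) :
    Digr (Quotient (omegaSetoid rel π c)) {e : E // χ e = c} :=
  (D.restrict (fun e => χ e = c)).quotient (omegaSetoid rel π c)

/-- `𝒢_{π,s} = (T|_{𝒞_s})/π_s`. -/
def Gps (D : Digr V E) (χ : E → C) (rel : S → C → Prop) (π : S → Setoid V) (s : S) :
    Digr (Quotient (π s)) {e : E // rel s (χ e)} :=
  (D.restrict (fun e => rel s (χ e))).quotient (π s)

/-- The map `h_{s,c} : V(T_{π,c}) → V(𝒢_{π,s})`, `[v]_{ω_{π,c}} ↦ [v]_{π_s}`. -/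
def hmap (rel : S → C → Prop) (π : S → Setoid V) {s : S} {c : C} (h : rel s c) :
    Quotient (omegaSetoid rel π c) → Quotient (π s) :=
  fun q => Quotient.liftOn q (fun v => Quotient.mk (π s) v)
    (fun a b hab => Quot.sound
      (Setoid.le_def.mp (iInf_le (fun s' : {s' : S // rel s' c} => π s'.1) ⟨s, h⟩) hab))

/-- The vertex set of the graph of colored components `GCC(T,π,s)`. -/
def GCCVert (D : Digr V E) (χ : E → C) (rel : S → C → Prop) (π : S → Setoid V) (s : S) :
    Type _ :=
  Quotient (π s) ⊕ (Σ c : {c : C // rel s c}, (Tpc D χ rel π c.1).Components)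

/-- The edge set of `GCC(T,π,s)`. -/
def GCCEdge (rel : S → C → Prop) (π : S → Setoid V) (s : S) : Type _ :=
  Σ c : {c : C // rel s c}, Quotient (omegaSetoid rel π c.1)

/-- The graph of colored components `GCC(T,π,s)`: the bipartite multigraph with an edge
for each `v ∈ V(T_{π,c})` (`c ∈ 𝒞_s`), joining the component of `T_{π,c}` containing `v`
to `h_{s,c}(v)`. -/
def GCC (D : Digr V E) (χ : E → C) (rel : S → C → Prop) (π : S → Setoid V) (s : S) :
    Digr (GCCVert D χ rel π s) (GCCEdge rel π s) where
  src := fun p => Sum.inr ⟨p.1, Quotient.mk (Tpc D χ rel π p.1.1).compSetoid p.2⟩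
  tgt := fun p => Sum.inl (hmap rel π p.1.2 p.2)

end Colored

/-! ### The matrix model -/

section Model

variable {S C : Type*}

/-- Index set for `⊗_{s ∈ 𝒮} M_N(ℂ)`. -/
abbrev BigIx (S : Type*) (N : ℕ) := S → Fin N

/-- Index set for `⊗_{s ∈ 𝒮_c} M_N(ℂ)`. -/
abbrev ColIx (rel : S → C → Prop) (c : C) (N : ℕ) := {s : S // rel s c} → Fin N

/-- View a matrix in `⊗_{s ∈ 𝒮_c} M_N(ℂ)` inside `⊗_{s ∈ 𝒮} M_N(ℂ)` by tensoring with
the identity on the remaining factors. -/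
noncomputable def embed [Fintype S] (rel : S → C → Prop) (c : C) {N : ℕ}
    (X : Matrix (ColIx rel c N) (ColIx rel c N) ℂ) :
    Matrix (BigIx S N) (BigIx S N) ℂ :=
  Matrix.of fun a b =>
    if (∀ s : S, ¬ rel s c → a s = b s) then X (fun s => a s.1) (fun s => b s.1) else 0

/-- The permutation matrix of a permutation. -/
def permMat {ι : Type*} [DecidableEq ι] (σ : Equiv.Perm ι) : Matrix ι ι ℂ :=
  Matrix.of fun i j => if σ j = i then 1 else 0

/-- `X̲ = Σ_c^* X Σ_c`, viewed inside `⊗_{s ∈ 𝒮} M_N(ℂ)`. -/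
noncomputable def conjEmbed [Fintype S] (rel : S → C → Prop) (c : C) {N : ℕ}
    (σc : Equiv.Perm (ColIx rel c N))
    (X : Matrix (ColIx rel c N) (ColIx rel c N) ℂ) :
    Matrix (BigIx S N) (BigIx S N) ℂ :=
  embed rel c ((permMat σc)ᴴ * X * permMat σc)

/-- `Δ`, the conditional expectation onto the diagonal. -/
def diagPart {ι : Type*} [DecidableEq ι] (M : Matrix ι ι ℂ) : Matrix ι ι ℂ :=
  Matrix.diagonal fun i => M i i

/-- The normalized `L²`-norm `‖M‖₂ = tr_n(M^*M)^{1/2}`. -/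
noncomputable def l2norm {ι : Type*} [Fintype ι] (M : Matrix ι ι ℂ) : ℝ :=
  Real.sqrt ((Matrix.trace (Mᴴ * M) / (Fintype.card ι : ℂ)).re)

/-- The operator norm of a matrix acting on Euclidean space. -/
noncomputable def opNorm {ι : Type*} [Fintype ι] [DecidableEq ι] (M : Matrix ι ι ℂ) : ℝ :=
  ‖Matrix.toEuclideanCLM (𝕜 := ℂ) M‖

/-- The ordered product `f 0 * f 1 * ⋯ * f (k-1)`. -/
def prodList {M : Type*} [Monoid M] (k : ℕ) (f : Fin k → M) : M :=
  ((List.finRange k).map f).prod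

/-- `γ_N(T,π)`. -/
noncomputable def gammaN {V E : Type*} [Fintype S] (rel : S → C → Prop)
    (D : Digr V E) (χ : E → C) (N : ℕ)
    (X : (e : E) → Matrix (ColIx rel (χ e) N) (ColIx rel (χ e) N) ℂ)
    (Λ : V → Matrix (BigIx S N) (BigIx S N) ℂ)
    (π : S → Setoid V)
    (σ : (c : C) → Equiv.Perm (ColIx rel c N)) : ℂ :=
  (1 / (N : ℂ) ^ (Nat.card S)) *
    ∑ᶠ i : V → BigIx S N,
      if (∀ s : S, Setoid.ker (fun v => i v s) = π s) then
        (∏ᶠ v : V, Λ v (i v) (i v)) *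
          ∏ᶠ e : E, (conjEmbed rel (χ e) (σ (χ e)) (X e)) (i (D.tgt e)) (i (D.src e))
      else 0

/-- `λ_N(T,π)`. -/
noncomputable def lambdaN {V : Type*} [Fintype S] (N : ℕ)
    (Λ : V → Matrix (BigIx S N) (BigIx S N) ℂ) (π : S → Setoid V) : ℂ :=
  (1 / (N : ℂ) ^ (∑ᶠ s : S, Nat.card (Quotient (π s)))) *
    ∑ᶠ i : V → BigIx S N,
      if (∀ s : S, Setoid.ker (fun v => i v s) = π s) then (∏ᶠ v : V, Λ v (i v) (i v))
      else 0

/-- `τ_{N^{#𝒮}}(T̊)`, the trace of the test digraph `T` with a `Λ_v`-labelled self-loop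
added at each vertex `v`. -/
noncomputable def ringTrace {V E : Type*} [Fintype S] (rel : S → C → Prop)
    (D : Digr V E) (χ : E → C) (N : ℕ)
    (X : (e : E) → Matrix (ColIx rel (χ e) N) (ColIx rel (χ e) N) ℂ)
    (Λ : V → Matrix (BigIx S N) (BigIx S N) ℂ)
    (σ : (c : C) → Equiv.Perm (ColIx rel c N)) : ℂ :=
  (1 / (N : ℂ) ^ (Nat.card S)) *
    ∑ᶠ i : V → BigIx S N,
      (∏ᶠ v : V, Λ v (i v) (i v)) *
        ∏ᶠ e : E, (conjEmbed rel (χ e) (σ (χ e)) (X e)) (i (D.tgt e)) (i (D.src e))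

/-- Expectation with respect to independent uniformly random permutations, one for each
color: the average over all tuples of permutations. -/
noncomputable def Eperm [Fintype S] (rel : S → C → Prop) (N : ℕ)
    (f : ((c : C) → Equiv.Perm (ColIx rel c N)) → ℂ) : ℂ :=
  (∑ᶠ σ : (c : C) → Equiv.Perm (ColIx rel c N), f σ) /
    (Nat.card ((c : C) → Equiv.Perm (ColIx rel c N)) : ℂ)

/-- Transport a matrix label along an equality of colors. -/
def castCol (rel : S → C → Prop) {N : ℕ} {c c' : C} (h : c = c')
    (X : Matrix (ColIx rel c N) (ColIx rel c N) ℂ) :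
    Matrix (ColIx rel c' N) (ColIx rel c' N) ℂ := h ▸ X

/-- The uniform probability measure on the tuples of permutations (with the discrete
`σ`-algebra). -/
noncomputable def uniformTupleMeasure [Fintype C] [Fintype S] (rel : S → C → Prop) (N : ℕ) :=
  letI : MeasurableSpace ((c : C) → Equiv.Perm (ColIx rel c N)) := ⊤
  haveI : Nonempty ((c : C) → Equiv.Perm (ColIx rel c N)) := ⟨fun _ => 1⟩
  ((PMF.uniformOfFintype ((c : C) → Equiv.Perm (ColIx rel c N))).toMeasure :
    Measure ((c : C) → Equiv.Perm (ColIx rel c N)))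

/-- The tuple `(Σ_c)_{c ∈ 𝒞}` of random permutations is uniformly distributed on the
product (equivalently, the `Σ_c` are independent and each uniform). -/
def hasUniformLaw [Fintype C] [Fintype S] (rel : S → C → Prop) {Ω : Type*}
    [MeasurableSpace Ω] (P : Measure Ω) (N : ℕ)
    (Sp : (c : C) → Ω → Equiv.Perm (ColIx rel c N)) : Prop :=
  letI : MeasurableSpace ((c : C) → Equiv.Perm (ColIx rel c N)) := ⊤
  Measure.map (fun ω c => Sp c ω) P = uniformTupleMeasure rel N

end Model

/-- A word `χ : [k] → 𝒞` is `𝒢`-reduced. -/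
def GReduced {C : Type*} (Edg : C → C → Prop) {k : ℕ} (χ : Fin k → C) : Prop :=
  ∀ i j : Fin k, i < j → χ i = χ j → ∃ l : Fin k, i < l ∧ l < j ∧ ¬ Edg (χ i) (χ l)

/-! ### Sofic groups and graph products of groups -/

/-- The normalized Hamming distance on `S_N`. -/
noncomputable def dHamm {n : ℕ} (σ τ : Equiv.Perm (Fin n)) : ℝ :=
  ((Finset.univ.filter fun j : Fin n => σ j ≠ τ j).card : ℝ) / n

/-- A group is sofic if it admits an asymptotic homomorphism into permutation groups. -/
def IsSofic (Γ : Type*) [Group Γ] : Prop :=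
  ∃ (Nk : ℕ → ℕ) (σ : (k : ℕ) → Γ → Equiv.Perm (Fin (Nk k))),
    Tendsto Nk atTop atTop ∧
    (∀ g h : Γ, Tendsto (fun k => dHamm (σ k g * σ k h) (σ k (g * h))) atTop (nhds 0)) ∧
    (∀ g : Γ, Tendsto (fun k => dHamm (σ k g) 1) atTop
      (nhds (if g = 1 then 0 else 1)))

/-- The normal subgroup of the free product generated by the commutators of elements of
vertex groups joined by an edge. -/
def graphProductKer {C : Type*} (Edg : C → C → Prop) (G : C → Type*)
    [∀ c, Group (G c)] : Subgroup (Monoid.CoprodI G) :=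
  Subgroup.normalClosure
    {x | ∃ (c c' : C) (_ : Edg c c') (g : G c) (g' : G c'),
      x = Monoid.CoprodI.of g * Monoid.CoprodI.of g' *
        (Monoid.CoprodI.of g)⁻¹ * (Monoid.CoprodI.of g')⁻¹}

/-- The graph product of the groups `(G c)_{c ∈ 𝒞}` over the graph with edge relation
`Edg`. -/
def GraphProduct {C : Type*} (Edg : C → C → Prop) (G : C → Type*) [∀ c, Group (G c)] :
    Type _ :=
  Monoid.CoprodI G ⧸ graphProductKer Edg G

instance graphProductKer_normal {C : Type*} (Edg : C → C → Prop) (G : C → Type*)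
    [∀ c, Group (G c)] : (graphProductKer Edg G).Normal :=
  Subgroup.normalClosure_normal

instance {C : Type*} (Edg : C → C → Prop) (G : C → Type*) [∀ c, Group (G c)] :
    Group (GraphProduct Edg G) :=
  QuotientGroup.Quotient.group _

/-- The group element corresponding to a word in the generators and their inverses:
the letter `(j, tt)` is `g_j`, and `(j, ff)` is `g_j⁻¹`. -/
def wordElemG {Γ : Type*} [Group Γ] (g : ℕ → Γ) {m : ℕ} (w : Fin m → ℕ × Bool) : Γ :=
  prodList m (fun i => if (w i).2 then g (w i).1 else (g (w i).1)⁻¹)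

/-- The matrix product corresponding to a word in permutation matrices and their
inverses. -/
noncomputable def wordMat {N m : ℕ} (T : ℕ → Equiv.Perm (Fin N)) (w : Fin m → ℕ × Bool) :
    Matrix (Fin N) (Fin N) ℂ :=
  prodList m (fun i => if (w i).2 then permMat (T (w i).1) else (permMat (T (w i).1))⁻¹)

/-! ### The proportion of moved points -/

section Moved

/-- The proportion of points moved by a permutation. -/
noncomputable def movedFrac {X : Type*} (σ : Equiv.Perm X) : ℝ :=
  ({x | σ x ≠ x} : Set X).ncard / Nat.card X

variable {X Y : Type*}

lemma movedFrac_nonneg (σ : Equiv.Perm X) : 0 ≤ movedFrac σ := by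
  unfold movedFrac; positivity

lemma movedFrac_le_one [Finite X] (σ : Equiv.Perm X) : movedFrac σ ≤ 1 := by
  unfold movedFrac
  apply div_le_one_of_le₀ _ (by positivity)
  exact_mod_cast Set.ncard_le_card _

lemma movedFrac_one : movedFrac (1 : Equiv.Perm X) = 0 := by
  simp [movedFrac]

lemma movedFrac_permCongr (e : X ≃ Y) (σ : Equiv.Perm X) :
    movedFrac (e.permCongr σ) = movedFrac σ := by
  unfold movedFrac
  rw [Nat.card_congr e]
  congr 2
  have : {y | e.permCongr σ y ≠ y} = e '' {x | σ x ≠ x} := by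
    ext y
    obtain ⟨x, rfl⟩ := e.surjective y
    simp [Equiv.permCongr_apply]
  rw [this, Set.ncard_image_of_injective _ e.injective]

lemma movedFrac_conj (σ τ : Equiv.Perm X) : movedFrac (τ * σ * τ⁻¹) = movedFrac σ :=
  movedFrac_permCongr τ σ

lemma movedFrac_inv (σ : Equiv.Perm X) : movedFrac σ⁻¹ = movedFrac σ := by
  unfold movedFrac
  congr 3
  ext x
  simp only [Set.mem_ofPred_eq, ne_eq, Equiv.Perm.inv_eq_iff_eq]
  exact not_congr eq_comm

lemma movedFrac_mul_le [Finite X] (σ τ : Equiv.Perm X) :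
    movedFrac (σ * τ) ≤ movedFrac σ + movedFrac τ := by
  unfold movedFrac
  rw [← add_div]
  gcongr
  have h1 : {x | (σ * τ) x ≠ x} ⊆ (τ ⁻¹' {x | σ x ≠ x}) ∪ {x | τ x ≠ x} := by
    intro x hx
    by_cases h : τ x = x
    · left
      simpa [h] using hx
    · exact Or.inr h
  have h2 : (τ ⁻¹' {x | σ x ≠ x}).ncard = {x | σ x ≠ x}.ncard :=
    Set.ncard_preimage_of_injective_subset_range τ.injective (by simp)
  calc (({x | (σ * τ) x ≠ x}.ncard : ℕ) : ℝ)
      ≤ (((τ ⁻¹' {x | σ x ≠ x}) ∪ {x | τ x ≠ x}).ncard : ℕ) := by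
        exact_mod_cast Set.ncard_le_ncard h1
    _ ≤ _ := by
        rw [← h2]
        exact_mod_cast Set.ncard_union_le _ _

lemma dHamm_eq_movedFrac {n : ℕ} (σ τ : Equiv.Perm (Fin n)) :
    dHamm σ τ = movedFrac (τ⁻¹ * σ) := by
  unfold dHamm movedFrac
  have : {x | (τ⁻¹ * σ) x ≠ x} = {x | σ x ≠ τ x} := by
    ext x
    simp only [ne_eq, Equiv.Perm.mul_apply, Equiv.Perm.inv_eq_iff_eq, Set.mem_ofPred_eq]
  rw [this, Nat.card_fin, ← Set.ncard_coe_finset]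
  simp

end Moved

/-! ### Sequences of permutations modulo asymptotically trivial ones -/

section NullSequences

/-- The sequences of permutations moving an asymptotically negligible proportion of points. -/
noncomputable def nullSubgroup (X : ℕ → Type*) [∀ k, Finite (X k)] :
    Subgroup (∀ k, Equiv.Perm (X k)) where
  carrier := {f | Tendsto (fun k => movedFrac (f k)) atTop (nhds 0)}
  one_mem' := by simp [movedFrac_one]
  mul_mem' {f g} hf hg :=
    squeeze_zero (fun _ => movedFrac_nonneg _) (fun k => movedFrac_mul_le (f k) (g k))
      (by simpa using Tendsto.add hf hg)
  inv_mem' {f} hf := by simpa [movedFrac_inv] using hf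

variable {X : ℕ → Type*} [∀ k, Finite (X k)]

lemma mem_nullSubgroup {f : ∀ k, Equiv.Perm (X k)} :
    f ∈ nullSubgroup X ↔ Tendsto (fun k => movedFrac (f k)) atTop (nhds 0) := Iff.rfl

instance nullSubgroup_normal : (nullSubgroup X).Normal where
  conj_mem f hf g := by
    rw [mem_nullSubgroup] at *
    simpa [movedFrac_conj] using hf

/-- Asymptotically equal sequences move asymptotically the same proportion of points. -/
lemma tendsto_movedFrac_of_mk_eq {f g : ∀ k, Equiv.Perm (X k)} {a : ℝ}
    (h : (f : (∀ k, Equiv.Perm (X k)) ⧸ nullSubgroup X) = g)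
    (hf : Tendsto (fun k => movedFrac (f k)) atTop (nhds a)) :
    Tendsto (fun k => movedFrac (g k)) atTop (nhds a) := by
  have hN : Tendsto (fun k => movedFrac ((f⁻¹ * g) k)) atTop (nhds 0) := QuotientGroup.eq.1 h
  refine tendsto_of_tendsto_of_dist hf (squeeze_zero (fun _ => dist_nonneg) (fun k => ?_) hN)
  rw [Real.dist_eq, abs_le]
  have h1 := movedFrac_mul_le (f k) ((f⁻¹ * g) k)
  have h2 := movedFrac_mul_le (g k) ((f⁻¹ * g) k)⁻¹
  rw [movedFrac_inv] at h2
  simp only [Pi.mul_apply, Pi.inv_apply, _root_.mul_inv_rev, inv_inv, mul_inv_cancel_left] at h1 h2 ⊢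
  constructor <;> linarith

/-- A group is sofic as soon as it maps to sequences of permutations modulo null sequences so
that nontrivial elements asymptotically move every point. -/
lemma isSofic_of_hom {Γ : Type*} [Group Γ]
    (hX : Tendsto (fun k => Nat.card (X k)) atTop atTop)
    (Ψ : Γ →* (∀ k, Equiv.Perm (X k)) ⧸ nullSubgroup X)
    (hΨ : ∀ γ : Γ, γ ≠ 1 → ∃ f : ∀ k, Equiv.Perm (X k), QuotientGroup.mk f = Ψ γ ∧
      Tendsto (fun k => movedFrac (f k)) atTop (nhds 1)) :
    IsSofic Γ := by
  choose L hL using fun γ => QuotientGroup.mk_surjective (Ψ γ)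
  let e : ∀ k, X k ≃ Fin (Nat.card (X k)) := fun k => Finite.equivFin (X k)
  refine ⟨fun k => Nat.card (X k), fun k γ => (e k).permCongrHom (L γ k), hX, fun g h => ?_,
    fun g => ?_⟩
  · have h1 : (QuotientGroup.mk (L (g * h)) : _ ⧸ nullSubgroup X) =
        QuotientGroup.mk (L g * L h) := by
      rw [QuotientGroup.mk_mul, hL, hL, hL, map_mul]
    have h2 := mem_nullSubgroup.1 (QuotientGroup.eq.1 h1)
    refine h2.congr fun k => ?_
    rw [dHamm_eq_movedFrac, ← map_mul, ← map_inv, ← map_mul]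
    exact (movedFrac_permCongr (e k) _).symm
  · have h1 : ∀ k, dHamm ((e k).permCongrHom (L g k)) 1 = movedFrac (L g k) := fun k => by
      rw [dHamm_eq_movedFrac, inv_one, one_mul]
      exact movedFrac_permCongr (e k) _
    simp only [h1]
    split_ifs with hg
    · have := (QuotientGroup.eq_one_iff (L g)).1 (by rw [hL, hg, map_one])
      exact this
    · obtain ⟨f, hf, hf'⟩ := hΨ g hg
      exact tendsto_movedFrac_of_mk_eq (hf.trans (hL g).symm) hf'

end NullSequences

/-! ### Reduced words -/

section Words

variable {C : Type*} (Edg : C → C → Prop)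

/-- Some letter `c` of the word can be shuffled to its front. -/
def Cancels (c : C) (w : List C) : Prop :=
  ∃ w₁ w₂, w = w₁ ++ c :: w₂ ∧ ∀ d ∈ w₁, Edg c d

/-- No two equal letters of the word can be shuffled next to each other. -/
def IsReducedWord : List C → Prop
  | [] => True
  | c :: w => ¬ Cancels Edg c w ∧ IsReducedWord w

/-- If, in every coordinate used by the colour `c`, the first relevant letter of `w` is `c`, then
`c` can be shuffled to the front of `w`. -/
lemma cancels_of_head?_filter {S A : Type*} {rel : S → C → Prop} (π : A → C)
    (hdisj : ∀ c d s, Edg c d → rel s c → ¬ rel s d)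
    (hsep : ∀ c d, ¬ Edg c d → ∃ s, rel s c ∧ rel s d) (hirr : ∀ c, ¬ Edg c c)
    {c : C} (w : List A)
    (h : ∀ s, rel s c → (w.filter fun x => rel s (π x)).head?.map π = some c) :
    Cancels Edg c (w.map π) := by
  induction w with
  | nil =>
    obtain ⟨s, hs, -⟩ := hsep c c (hirr c)
    simpa using h s hs
  | cons x w ih =>
    by_cases hx : π x = c
    · exact ⟨[], w.map π, by simp [hx], by simp⟩
    by_cases hE : Edg c (π x)
    · obtain ⟨w₁, w₂, h₁, h₂⟩ := ih fun s hs => by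
        simpa [List.filter_cons, hdisj c _ s hE hs] using h s hs
      refine ⟨π x :: w₁, w₂, by simp [h₁], ?_⟩
      simpa [hE] using h₂
    · obtain ⟨s, hs, hs'⟩ := hsep c _ hE
      have := h s hs
      simp [hs', hx] at this

end Words

/-! ### A finite model of a graph product of finite groups -/

section Stack

variable {S C : Type*} (rel : S → C → Prop) (A : C → Type*) [∀ c, Group (A c)] (n : ℕ)

/-- Words of length at most `n`. -/
abbrev Stack : Type _ := {l : List (Σ c, A c) // l.length ≤ n}

variable {A n} in
/-- The states in which a nontrivial letter of colour `c` can be pushed. -/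
abbrev OpenState (c : C) : Type _ :=
  {v : {s // rel s c} → Stack A n //
    (¬ ∃ x : A c, ∀ s, (v s).1.head? = some ⟨c, x⟩) ∧ ∀ s, (v s).1.length < n}

variable {A n} in
/-- Push the letter `x` on all stacks of colour `c`, unless it is trivial. -/
noncomputable def pushState (c : C) (p : OpenState rel (A := A) (n := n) c × A c) :
    {s // rel s c} → Stack A n :=
  if p.2 = 1 then p.1.1 else fun s => ⟨⟨c, p.2⟩ :: (p.1.1 s).1, p.1.2.2 s⟩

variable {rel A n} in
lemma pushState_injective {c : C} (hc : ∃ s, rel s c) :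
    Function.Injective (pushState rel (A := A) (n := n) c) := by
  obtain ⟨s₀, hs₀⟩ := hc
  rintro ⟨v, x⟩ ⟨w, y⟩ h
  unfold pushState at h
  dsimp only at h
  split_ifs at h with hx hy hy
  · rw [Subtype.ext h, hx, hy]
  · refine absurd ⟨y, fun s => ?_⟩ v.2.1
    rw [h]; rfl
  · refine absurd ⟨x, fun s => ?_⟩ w.2.1
    rw [← h]; rfl
  · have h1 := fun s => congrArg Subtype.val (congrFun h s)
    simp only [List.cons.injEq, Sigma.mk.injEq, heq_eq_eq, true_and] at h1
    refine Prod.ext (Subtype.ext (funext fun s => Subtype.ext (h1 s).2)) (h1 ⟨s₀, hs₀⟩).1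

/-- Left multiplication on the second factor. -/
def mulSndHom (V B : Type*) [Group B] : B →* Equiv.Perm (V × B) where
  toFun b := Equiv.prodCongr (Equiv.refl V) (Equiv.mulLeft b)
  map_one' := by ext p <;> simp
  map_mul' a b := by ext p <;> simp [mul_assoc]

/-- A permutation of the coordinates of colour `c`, acting on all coordinates. -/
noncomputable def localPerm {W : Type*} (c : C) :
    Equiv.Perm ({s // rel s c} → W) →* Equiv.Perm (S → W) where
  toFun f := (Equiv.piEquivPiSubtypeProd (fun s => rel s c) (fun _ => W)).symm.permCongr
    (Equiv.prodCongr f (Equiv.refl _))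
  map_one' := by ext u s; simp [Equiv.permCongr_apply]
  map_mul' f g := by ext u s; simp [Equiv.permCongr_apply]

lemma localPerm_apply {W : Type*} (c : C) (f : Equiv.Perm ({s // rel s c} → W)) (u : S → W)
    (s : S) : localPerm rel c f u s = if h : rel s c then f (fun t => u t) ⟨s, h⟩ else u s := by
  simp [localPerm, Equiv.permCongr_apply, Equiv.piEquivPiSubtypeProd]

lemma localPerm_commute {W : Type*} {c d : C} (h : ∀ s, rel s c → ¬ rel s d)
    (f : Equiv.Perm ({s // rel s c} → W)) (g : Equiv.Perm ({s // rel s d} → W)) :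
    Commute (localPerm rel c f) (localPerm rel d g) := by
  ext u s
  have h1 : (fun t : {s // rel s c} => localPerm rel d g u t) = fun t => u t.1 := funext fun t => by
    rw [localPerm_apply, dif_neg (h t t.2)]
  have h2 : (fun t : {s // rel s d} => localPerm rel c f u t) = fun t => u t.1 := funext fun t => by
    rw [localPerm_apply, dif_neg fun h' => h t h' t.2]
  rw [Equiv.Perm.mul_apply, Equiv.Perm.mul_apply,
    localPerm_apply rel c f (localPerm rel d g u), localPerm_apply rel d g (localPerm rel c f u),
    h1, h2, localPerm_apply rel c f u s, localPerm_apply rel d g u s]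
  have := h s
  split_ifs <;> first | rfl | (exfalso; tauto)

variable {rel} (hrel : ∀ c, ∃ s, rel s c)

/-- The action of a vertex group on tuples of stacks. -/
noncomputable def stackHom (c : C) : A c →* Equiv.Perm (S → Stack A n) :=
  (localPerm rel c).comp ((Equiv.Perm.viaEmbeddingHom
    ⟨pushState rel c, pushState_injective (hrel c)⟩).comp
      (mulSndHom (OpenState rel (A := A) (n := n) c) (A c)))

variable {A} in
/-- The state recording, in each coordinate, the letters of `l` relevant for it. -/
noncomputable def wordState (rel : S → C → Prop) {n : ℕ} (l : List (Σ c, A c))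
    (hl : l.length ≤ n) : S → Stack A n :=
  fun s => ⟨l.filter fun x => rel s x.1, (List.length_filter_le _ _).trans hl⟩

variable {A n} in
lemma stackHom_wordState {Edg : C → C → Prop}
    (hdisj : ∀ c d s, Edg c d → rel s c → ¬ rel s d)
    (hsep : ∀ c d, ¬ Edg c d → ∃ s, rel s c ∧ rel s d) (hirr : ∀ c, ¬ Edg c c)
    {c : C} {a : A c} (ha : a ≠ 1) (l : List (Σ c, A c))
    (hl : (⟨c, a⟩ :: l : List (Σ c, A c)).length ≤ n)
    (hc : ¬ Cancels Edg c (l.map Sigma.fst)) :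
    stackHom A n hrel c a (wordState rel l (Nat.le_of_succ_le hl)) =
      wordState rel (⟨c, a⟩ :: l) hl := by
  set u := wordState rel l (Nat.le_of_succ_le hl)
  let v : OpenState rel (A := A) (n := n) c := ⟨fun s => u s, by
    rintro ⟨x, hx⟩
    refine hc (cancels_of_head?_filter Edg Sigma.fst hdisj hsep hirr l fun s hs => ?_)
    have := hx ⟨s, hs⟩
    simp only [u, wordState] at this
    rw [this]; rfl, fun s => (List.length_filter_le _ _).trans_lt hl⟩
  have hv : (fun t : {s // rel s c} => u t) = pushState rel c (v, 1) := by
    simp [pushState, v]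
  have hva : Equiv.Perm.viaEmbeddingHom ⟨pushState rel c, pushState_injective (hrel c)⟩
      (mulSndHom (OpenState rel (A := A) (n := n) c) (A c) a) (fun t => u t) =
        pushState rel c (v, a) := by
    rw [hv]
    refine (Equiv.Perm.viaEmbedding_apply _ ⟨pushState rel c, pushState_injective (hrel c)⟩
      (v, 1)).trans ?_
    simp [mulSndHom]
  ext1 s
  simp only [stackHom, MonoidHom.comp_apply]
  rw [localPerm_apply, hva]
  apply Subtype.ext
  by_cases hs : rel s c
  · simp [pushState, ha, hs, wordState, v, u]
  · simp [hs, wordState, u]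

/-- The combinatorial core: reduced words in nontrivial letters act nontrivially. -/
lemma stackHom_prod_ne_one {Edg : C → C → Prop}
    (hdisj : ∀ c d s, Edg c d → rel s c → ¬ rel s d)
    (hsep : ∀ c d, ¬ Edg c d → ∃ s, rel s c ∧ rel s d) (hirr : ∀ c, ¬ Edg c c)
    {l : List (Σ c, A c)} (hne : l ≠ []) (hl : l.length ≤ n) (h1 : ∀ x ∈ l, x.2 ≠ 1)
    (hred : IsReducedWord Edg (l.map Sigma.fst)) :
    (l.map fun x => stackHom A n hrel x.1 x.2).prod ≠ 1 := by
  have key : ∀ (l : List (Σ c, A c)) (hl : l.length ≤ n), (∀ x ∈ l, x.2 ≠ 1) →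
      IsReducedWord Edg (l.map Sigma.fst) →
      (l.map fun x => stackHom A n hrel x.1 x.2).prod (wordState rel [] (Nat.zero_le n)) =
        wordState rel l hl := by
    intro l
    induction l with
    | nil => intros; rfl
    | cons x l ih =>
      intro hl h1 hred
      rw [List.map_cons, List.prod_cons, Equiv.Perm.mul_apply,
        ih (Nat.le_of_succ_le hl) (fun y hy => h1 y (by simp [hy])) hred.2]
      exact stackHom_wordState hrel hdisj hsep hirr (h1 x (by simp)) l hl hred.1
  intro h
  have h2 := key l hl h1 hred
  rw [h] at h2
  obtain ⟨x, l, rfl⟩ := List.exists_cons_of_ne_nil hne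
  obtain ⟨s, hs⟩ := hrel x.1
  have h3 := congrArg Subtype.val (congrFun h2 s)
  simp [wordState, hs] at h3

end Stack

/-! ### Permutations acting through a coordinate of a finite group -/

section Coordinate

variable {A Q : Type*} [Group A] [Group Q]

/-- A group with a retraction onto `A` splits as a product set. -/
def retractEquiv (p : Q →* A) (i : A →* Q) (h : ∀ a, p (i a) = a) : Q ≃ A × p.ker where
  toFun z := (p z, ⟨(i (p z))⁻¹ * z, by simp [MonoidHom.mem_ker, h]⟩)
  invFun x := i x.1 * x.2
  left_inv z := by simp
  right_inv x := by
    have := MonoidHom.mem_ker.1 x.2.2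
    ext <;> simp [h, this]

/-- Permutations of `A` acting on a group with a retraction onto `A`. -/
def coordPerm (p : Q →* A) (i : A →* Q) (h : ∀ a, p (i a) = a) :
    Equiv.Perm A →* Equiv.Perm Q where
  toFun σ := (retractEquiv p i h).symm.permCongr (Equiv.prodCongr σ (Equiv.refl _))
  map_one' := by ext z; simp [Equiv.permCongr_apply]
  map_mul' σ τ := by ext z; simp [Equiv.permCongr_apply, Prod.map]

lemma coordPerm_apply (p : Q →* A) (i : A →* Q) (h : ∀ a, p (i a) = a) (σ : Equiv.Perm A)
    (z : Q) : coordPerm p i h σ z = i (σ (p z) * (p z)⁻¹) * z := by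
  simp [coordPerm, Equiv.permCongr_apply, retractEquiv, mul_assoc]

lemma movedFrac_prodCongr_refl {X Y : Type*} [Finite Y] [Nonempty Y] (σ : Equiv.Perm X) :
    movedFrac (Equiv.prodCongr σ (Equiv.refl Y)) = movedFrac σ := by
  unfold movedFrac
  have h1 : {x : X × Y | Equiv.prodCongr σ (Equiv.refl Y) x ≠ x} =
      {x | σ x ≠ x} ×ˢ Set.univ := by
    ext x
    simp [Prod.ext_iff]
  rw [h1, Set.ncard_prod, Set.ncard_univ, Nat.card_prod, Nat.cast_mul, Nat.cast_mul,
    mul_div_mul_right _ _ (by exact_mod_cast Nat.card_pos.ne')]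

lemma movedFrac_coordPerm [Finite Q] (p : Q →* A) (i : A →* Q) (h : ∀ a, p (i a) = a)
    (σ : Equiv.Perm A) : movedFrac (coordPerm p i h σ) = movedFrac σ :=
  (movedFrac_permCongr _ _).trans (movedFrac_prodCongr_refl σ)

lemma coordPerm_commute {B : Type*} [Group B] (p : Q →* A) (i : A →* Q) (h : ∀ a, p (i a) = a)
    (q : Q →* B) (j : B →* Q) (h' : ∀ b, q (j b) = b) (hpj : ∀ b, p (j b) = 1)
    (hqi : ∀ a, q (i a) = 1) (hij : ∀ a b, Commute (i a) (j b))
    (σ : Equiv.Perm A) (τ : Equiv.Perm B) :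
    Commute (coordPerm p i h σ) (coordPerm q j h' τ) := by
  ext z
  simp only [Equiv.Perm.mul_apply, coordPerm_apply, map_mul p, map_mul q, hpj, hqi, one_mul]
  rw [← mul_assoc, ← mul_assoc, (hij _ _).eq]

lemma one_sub_movedFrac {X : Type*} [Finite X] [Nonempty X] (σ : Equiv.Perm X) :
    1 - movedFrac σ = ({x | σ x = x} : Set X).ncard / Nat.card X := by
  have h0 : (Nat.card X : ℝ) ≠ 0 := by exact_mod_cast Nat.card_pos.ne'
  have h1 : ({x | σ x = x} : Set X).ncard + ({x | σ x ≠ x} : Set X).ncard = Nat.card X :=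
    Set.ncard_add_ncard_compl _
  rw [movedFrac, eq_div_iff h0, sub_mul, div_mul_cancel₀ _ h0, ← h1]
  push_cast
  ring

variable {C : Type*} {A : C → Type*} [∀ c, Group (A c)] [Finite Q]

/-- If no product of nontrivial letters coloured like `l` is trivial, then a fixed point of the
product of `l` is due to a fixed point of one of the factors. -/
lemma le_movedFrac_prod_coordPerm (p : ∀ c, Q →* A c) (i : ∀ c, A c →* Q)
    (h : ∀ c a, p c (i c a) = a) (l : List (Σ c, Equiv.Perm (A c)))
    (hl : ∀ b : List (Σ c, A c), b.map Sigma.fst = l.map Sigma.fst → (∀ x ∈ b, x.2 ≠ 1) →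
      (b.map fun x => i x.1 x.2).prod ≠ 1) :
    1 - (l.map fun x => 1 - movedFrac x.2).sum ≤
      movedFrac (l.map fun x => coordPerm (p x.1) (i x.1) (h x.1) x.2).prod := by
  have key : ∀ l : List (Σ c, Equiv.Perm (A c)), ∃ B : Set Q,
      (B.ncard / Nat.card Q : ℝ) ≤ (l.map fun x => 1 - movedFrac x.2).sum ∧
      ∀ z ∉ B, ∃ b : List (Σ c, A c), b.map Sigma.fst = l.map Sigma.fst ∧ (∀ x ∈ b, x.2 ≠ 1) ∧
        (l.map fun x => coordPerm (p x.1) (i x.1) (h x.1) x.2).prod z =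
          (b.map fun x => i x.1 x.2).prod * z := by
    intro l
    induction l with
    | nil => exact ⟨∅, by simp, fun z _ => ⟨[], by simp⟩⟩
    | cons x l ih =>
      obtain ⟨B, hB, hB'⟩ := ih
      set Θ := (l.map fun x => coordPerm (p x.1) (i x.1) (h x.1) x.2).prod with hΘ
      set φ := coordPerm (p x.1) (i x.1) (h x.1) x.2 with hφ
      refine ⟨Θ ⁻¹' {z | φ z = z} ∪ B, ?_, fun z hz => ?_⟩
      · have h1 : (Θ ⁻¹' {z | φ z = z}).ncard = {z | φ z = z}.ncard :=
          Set.ncard_preimage_of_injective_subset_range Θ.injective (by simp)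
        rw [List.map_cons, List.sum_cons, ← movedFrac_coordPerm (p x.1) (i x.1) (h x.1) x.2,
          one_sub_movedFrac]
        refine le_trans ?_ (add_le_add_right hB _)
        rw [← add_div, ← hφ, ← h1]
        gcongr
        exact_mod_cast Set.ncard_union_le _ _
      · rw [Set.mem_union, not_or] at hz
        obtain ⟨b, hb, hb', hbz⟩ := hB' z hz.2
        refine ⟨⟨x.1, x.2 (p x.1 (Θ z)) * (p x.1 (Θ z))⁻¹⟩ :: b, by simp [hb], ?_, ?_⟩
        · intro y hy
          rcases List.mem_cons.1 hy with rfl | hy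
          · intro h1
            dsimp only at h1
            refine hz.1 ?_
            rw [Set.mem_preimage, Set.mem_ofPred_eq, hφ, coordPerm_apply, h1, map_one, one_mul]
          · exact hb' y hy
        · rw [List.map_cons, List.prod_cons, List.map_cons, List.prod_cons, Equiv.Perm.mul_apply,
            ← hΘ, coordPerm_apply, mul_assoc, ← hbz]
  obtain ⟨B, hB, hB'⟩ := key l
  rw [sub_le_comm, one_sub_movedFrac]
  refine le_trans ?_ hB
  gcongr
  · exact Set.toFinite B
  · intro z hz
    by_contra hzB
    obtain ⟨b, hb, hb', hbz⟩ := hB' z hzB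
    exact hl b hb hb' (mul_eq_right.1 (hbz.symm.trans hz))

end Coordinate

section Model

variable {C : Type} [Finite C] {Edg : C → C → Prop}

/-- Finite permutation models for graph products of symmetric groups. -/
lemma exists_permModel (hsymm : ∀ c d, Edg c d → Edg d c) (hirr : ∀ c, ¬ Edg c c)
    (A : C → Type) [∀ c, Group (A c)] [∀ c, Finite (A c)] (n : ℕ) :
    ∃ (X : Type) (_ : Finite X) (Φ : ∀ c, Equiv.Perm (A c) →* Equiv.Perm X),
      n ≤ Nat.card X ∧ (∀ c σ, movedFrac (Φ c σ) = movedFrac σ) ∧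
      (∀ c d, Edg c d → ∀ σ τ, Commute (Φ c σ) (Φ d τ)) ∧
      ∀ l : List (Σ c, Equiv.Perm (A c)), l ≠ [] → l.length ≤ n →
        IsReducedWord Edg (l.map Sigma.fst) →
        1 - (l.map fun x => 1 - movedFrac x.2).sum ≤
          movedFrac (l.map fun x => Φ x.1 x.2).prod := by
  let rel : C × C → C → Prop := fun s c => ¬ Edg s.1 s.2 ∧ (s.1 = c ∨ s.2 = c)
  have hdisj : ∀ c d s, Edg c d → rel s c → ¬ rel s d := by
    rintro c d ⟨s, t⟩ hE ⟨h, h1⟩ ⟨-, h2⟩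
    dsimp only at h h1 h2
    rcases h1 with rfl | rfl <;> rcases h2 with rfl | rfl
    exacts [hirr _ hE, h hE, h (hsymm _ _ hE), hirr _ hE]
  have hsep : ∀ c d, ¬ Edg c d → ∃ s, rel s c ∧ rel s d := fun c d h =>
    ⟨(c, d), ⟨h, Or.inl rfl⟩, ⟨h, Or.inr rfl⟩⟩
  have hrel : ∀ c, ∃ s, rel s c := fun c => ⟨(c, c), hirr c, Or.inl rfl⟩
  have : Finite (Stack A n) := (List.finite_length_le _ n).to_subtype
  let Q := Equiv.Perm (C × C → Stack A n) × (∀ c, A c) × Multiplicative (ZMod (n + 1))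
  let p : ∀ c, Q →* A c := fun c =>
    (Pi.evalMonoidHom A c).comp ((MonoidHom.fst _ _).comp (MonoidHom.snd _ _))
  let i : ∀ c, A c →* Q := fun c =>
    (stackHom A n hrel c).prod ((MonoidHom.mulSingle A c).prod 1)
  have hpi : ∀ c a, p c (i c a) = a := fun c a => Pi.mulSingle_eq_same c a
  have hpi' : ∀ c d, Edg c d → ∀ a, p c (i d a) = 1 := fun c d h a => by
    have : c ≠ d := fun e => hirr c (by rw [← e] at h; exact h)
    exact Pi.mulSingle_eq_of_ne this a
  have : Finite (Multiplicative (ZMod (n + 1))) := inferInstanceAs (Finite (Fin (n + 1)))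
  have : Finite Q := inferInstance
  refine ⟨Q, this, fun c => coordPerm (p c) (i c) (hpi c), ?_,
    fun c => movedFrac_coordPerm _ _ _, fun c d hE => ?_, fun l hne hl hred => ?_⟩
  · have h1 : Function.Surjective (fun z : Q => z.2.2) := fun x => ⟨(1, 1, x), rfl⟩
    have h2 := Nat.card_le_card_of_surjective _ h1
    have h3 : Nat.card (Multiplicative (ZMod (n + 1))) = n + 1 := by
      simp
    omega
  · refine coordPerm_commute _ _ _ _ _ _ (hpi' c d hE) (hpi' d c (hsymm _ _ hE)) fun a b => ?_
    have hcd : c ≠ d := fun e => hirr c (by rw [← e] at hE; exact hE)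
    refine Commute.prod (localPerm_commute rel (fun s => hdisj c d s hE) _ _)
      (Commute.prod (Pi.mulSingle_commute hcd a b) (Commute.one_left _))
  · refine le_movedFrac_prod_coordPerm p i hpi l fun b hb hb1 hprod => ?_
    have hb0 : b ≠ [] := by rintro rfl; simp at hb; exact hne hb
    have hbl : b.length ≤ n := by
      have := congrArg List.length hb
      simp only [List.length_map] at this
      omega
    refine stackHom_prod_ne_one A n hrel hdisj hsep hirr hb0 hbl hb1 (hb ▸ hred) ?_
    have := congrArg (MonoidHom.fst _ _) hprod
    rw [map_list_prod, List.map_map] at this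
    exact this

end Model

/-! ### Graph products -/

section GraphProducts

variable {C : Type*} {Edg : C → C → Prop} {G : C → Type*} [∀ c, Group (G c)]

/-- The canonical map of a vertex group to the graph product. -/
def graphProductOf (Edg : C → C → Prop) (G : C → Type*) [∀ c, Group (G c)] (c : C) :
    G c →* GraphProduct Edg G :=
  (QuotientGroup.mk' (graphProductKer Edg G)).comp Monoid.CoprodI.of

lemma graphProductOf_commute {c d : C} (h : Edg c d) (g : G c) (g' : G d) :
    Commute (graphProductOf Edg G c g) (graphProductOf Edg G d g') := by
  have h1 : (Monoid.CoprodI.of g * Monoid.CoprodI.of g' * (Monoid.CoprodI.of g)⁻¹ *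
      (Monoid.CoprodI.of g')⁻¹ : Monoid.CoprodI G) ∈ graphProductKer Edg G :=
    Subgroup.subset_normalClosure ⟨c, d, h, g, g', rfl⟩
  have h2 := (QuotientGroup.eq_one_iff _).2 h1
  exact commutatorElement_eq_one_iff_commute.1 h2

/-- The element represented by a word in the vertex groups. -/
def graphProductEval (Edg : C → C → Prop) (l : List (Σ c, G c)) : GraphProduct Edg G :=
  (l.map fun x => graphProductOf Edg G x.1 x.2).prod

lemma graphProductEval_surjective (γ : GraphProduct Edg G) :
    ∃ l : List (Σ c, G c), graphProductEval Edg l = γ := by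
  obtain ⟨x, rfl⟩ := QuotientGroup.mk'_surjective _ γ
  induction x using Monoid.CoprodI.induction_on with
  | one => exact ⟨[], (map_one _).symm⟩
  | of c g => exact ⟨[⟨c, g⟩], mul_one _⟩
  | mul x y hx hy =>
    obtain ⟨l, hl⟩ := hx
    obtain ⟨l', hl'⟩ := hy
    refine ⟨l ++ l', ?_⟩
    rw [map_mul, ← hl, ← hl', graphProductEval, List.map_append, List.prod_append]
    rfl

/-- A word is either reduced with nontrivial letters, or can be shortened. -/
lemma isReducedWord_or_shorter (l : List (Σ c, G c)) :
    (IsReducedWord Edg (l.map Sigma.fst) ∧ ∀ x ∈ l, x.2 ≠ 1) ∨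
      ∃ l' : List (Σ c, G c), l'.length < l.length ∧
        graphProductEval Edg l' = graphProductEval Edg l := by
  induction l with
  | nil => exact Or.inl ⟨trivial, by simp⟩
  | cons x l ih =>
    rcases ih with ⟨hred, h1⟩ | ⟨l', hl', he⟩
    · by_cases hx : x.2 = 1
      · exact Or.inr ⟨l, by simp, by simp [graphProductEval, hx]⟩
      by_cases hc : Cancels Edg x.1 (l.map Sigma.fst)
      · right
        obtain ⟨c, g⟩ := x
        obtain ⟨w₁, w₂, hw, hE⟩ := hc
        obtain ⟨l₁, l₂', rfl, rfl, hl₂⟩ := List.map_eq_append_iff.1 hw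
        obtain ⟨⟨c', g'⟩, l₂, rfl, hc', rfl⟩ := List.map_eq_cons_iff.1 hl₂
        obtain rfl : c' = c := hc'
        refine ⟨l₁ ++ ⟨c', g * g'⟩ :: l₂, by simp, ?_⟩
        have hcomm : Commute (graphProductOf Edg G c' g)
            (l₁.map fun x => graphProductOf Edg G x.1 x.2).prod := by
          refine Commute.list_prod_right _ _ fun y hy => ?_
          obtain ⟨z, hz, rfl⟩ := List.mem_map.1 hy
          exact graphProductOf_commute (hE _ (List.mem_map_of_mem hz)) _ _
        simp only [graphProductEval, List.map_append, List.prod_append, List.map_cons,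
          List.prod_cons, map_mul]
        rw [← mul_assoc, ← mul_assoc, ← hcomm.eq]
        simp only [mul_assoc]
      · refine Or.inl ⟨⟨hc, hred⟩, fun y hy => ?_⟩
        rcases List.mem_cons.1 hy with rfl | hy
        exacts [hx, h1 y hy]
    · refine Or.inr ⟨x :: l', by simpa using hl', ?_⟩
      simp only [graphProductEval, List.map_cons, List.prod_cons] at he ⊢
      rw [he]

lemma exists_reducedWord (γ : GraphProduct Edg G) :
    ∃ l : List (Σ c, G c), graphProductEval Edg l = γ ∧
      IsReducedWord Edg (l.map Sigma.fst) ∧ ∀ x ∈ l, x.2 ≠ 1 := by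
  obtain ⟨l, rfl⟩ := graphProductEval_surjective γ
  induction hn : l.length using Nat.strong_induction_on generalizing l with
  | _ n ih =>
    subst hn
    rcases isReducedWord_or_shorter (Edg := Edg) l with h | ⟨l', hl', he⟩
    · exact ⟨l, rfl, h⟩
    · rw [← he]
      exact ih _ hl' l' rfl

/-- The universal property of graph products. -/
def graphProductLift {H : Type*} [Group H] (ψ : ∀ c, G c →* H)
    (hψ : ∀ c d, Edg c d → ∀ g g', Commute (ψ c g) (ψ d g')) : GraphProduct Edg G →* H :=
  QuotientGroup.lift (graphProductKer Edg G) (Monoid.CoprodI.lift ψ) <| by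
    refine Subgroup.normalClosure_le_normal (N := (Monoid.CoprodI.lift ψ).ker) ?_
    rintro x ⟨c, d, h, g, g', rfl⟩
    simp only [SetLike.mem_coe, MonoidHom.mem_ker, map_mul, map_inv, Monoid.CoprodI.lift_of]
    exact commutatorElement_eq_one_iff_commute.2 (hψ c d h g g')

lemma graphProductLift_eval {H : Type*} [Group H] (ψ : ∀ c, G c →* H)
    (hψ : ∀ c d, Edg c d → ∀ g g', Commute (ψ c g) (ψ d g')) (l : List (Σ c, G c)) :
    graphProductLift ψ hψ (graphProductEval Edg l) = (l.map fun x => ψ x.1 x.2).prod := by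
  rw [graphProductEval, map_list_prod, List.map_map]
  exact congrArg List.prod (List.map_congr_left fun x _ => Monoid.CoprodI.lift_of ψ x.2)

end GraphProducts

/-- Sofic approximations may be taken on the underlying sets of finite groups. -/
lemma IsSofic.exists_approx {Γ : Type*} [Group Γ] (h : IsSofic Γ) :
    ∃ (A : ℕ → Type) (_ : ∀ k, Group (A k)) (_ : ∀ k, Finite (A k))
      (σ : ∀ k, Γ → Equiv.Perm (A k)),
      (∀ g g', Tendsto (fun k => movedFrac ((σ k (g * g'))⁻¹ * (σ k g * σ k g'))) atTop
        (nhds 0)) ∧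
      ∀ g, g ≠ 1 → Tendsto (fun k => movedFrac (σ k g)) atTop (nhds 1) := by
  obtain ⟨N, σ, hN, hmul, hid⟩ := h
  obtain ⟨K, hK⟩ := eventually_atTop.1 (hN.eventually_ge_atTop 1)
  have : ∀ k, NeZero (N (k + K)) := fun k => ⟨Nat.one_le_iff_ne_zero.1 (hK _ (Nat.le_add_left K k))⟩
  let e : ∀ k, Fin (N (k + K)) ≃ Multiplicative (ZMod (N (k + K))) := fun k =>
    (ZMod.finEquiv _).toEquiv.trans Multiplicative.ofAdd
  refine ⟨fun k => Multiplicative (ZMod (N (k + K))), fun k => inferInstance,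
    fun k => Finite.of_equiv _ (e k), fun k g => (e k).permCongrHom (σ (k + K) g),
    fun g g' => ?_, fun g hg => ?_⟩
  · refine ((tendsto_add_atTop_iff_nat K).2 (hmul g g')).congr fun k => ?_
    rw [dHamm_eq_movedFrac, ← map_mul, ← map_inv, ← map_mul]
    exact (movedFrac_permCongr (e k) _).symm
  · have h1 := (tendsto_add_atTop_iff_nat K).2 (hid g)
    rw [if_neg hg] at h1
    refine h1.congr fun k => ?_
    rw [dHamm_eq_movedFrac, inv_one, one_mul]
    exact (movedFrac_permCongr (e k) _).symm

/-- **Proposition (graph products of sofic groups are sofic).** -/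
theorem statement2 {C : Type} [Fintype C]
    (Edg : C → C → Prop) (hsymm : Symmetric Edg) (hirr : ∀ c : C, ¬ Edg c c)
    (G : C → Type) [∀ c, Group (G c)] [∀ c, Countable (G c)]
    (hsofic : ∀ c : C, IsSofic (G c)) :
    IsSofic (GraphProduct Edg G) := by
  choose A _ _ σ hmul hid using fun c => (hsofic c).exists_approx
  choose X _ Φ hcard hmoved hcomm hred using fun k =>
    exists_permModel (Edg := Edg) (fun _ _ h => hsymm h) hirr (fun c => A c k) k
  let f : ∀ c, G c → ∀ k, Equiv.Perm (X k) := fun c g k => Φ k c (σ c k g)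
  let ψ : ∀ c, G c →* (∀ k, Equiv.Perm (X k)) ⧸ nullSubgroup X := fun c =>
    MonoidHom.mk' (fun g => QuotientGroup.mk (f c g)) fun g g' => by
      refine QuotientGroup.eq.2 (mem_nullSubgroup.2 ((hmul c g g').congr fun k => ?_))
      simp only [f, Pi.mul_apply, Pi.inv_apply]
      rw [← map_mul, ← map_inv, ← map_mul, hmoved]
  have hψ : ∀ c d, Edg c d → ∀ g g', Commute (ψ c g) (ψ d g') := fun c d h g g' => by
    have h1 : Commute (f c g) (f d g') := funext fun k => hcomm k c d h _ _
    exact h1.map (QuotientGroup.mk' (nullSubgroup X))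
  refine isSofic_of_hom (tendsto_atTop_mono hcard tendsto_id) (graphProductLift ψ hψ)
    fun γ hγ => ?_
  obtain ⟨l, rfl, hl, hl1⟩ := exists_reducedWord γ
  have hne : l ≠ [] := by rintro rfl; exact hγ rfl
  refine ⟨(l.map fun x => f x.1 x.2).prod, ?_, ?_⟩
  · rw [graphProductLift_eval]
    refine (map_list_prod (QuotientGroup.mk' (nullSubgroup X)) _).trans ?_
    rw [List.map_map]
    rfl
  · have hlow : Tendsto (fun k => 1 - (l.map fun x => 1 - movedFrac (σ x.1 k x.2)).sum) atTop
        (nhds 1) := by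
      have h1 : Tendsto (fun k => (l.map fun x => 1 - movedFrac (σ x.1 k x.2)).sum) atTop
          (nhds (l.map fun _ => (0 : ℝ)).sum) :=
        tendsto_list_sum l fun x hx => by
          simpa using (hid x.1 x.2 (hl1 x hx)).const_sub 1
      simpa using h1.const_sub 1
    refine tendsto_of_tendsto_of_tendsto_of_le_of_le' hlow tendsto_const_nhds ?_
      (Eventually.of_forall fun k => movedFrac_le_one _)
    filter_upwards [eventually_ge_atTop l.length] with k hk
    have h1 := hred k (l.map fun x => ⟨x.1, σ x.1 k x.2⟩) (by simpa using hne)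
      (by simpa using hk) (by rw [List.map_map]; exact hl)
    simp only [List.map_map] at h1
    refine h1.trans_eq ?_
    congr 1
    rw [Pi.list_prod_apply, List.map_map]
    rfl

end GraphPaper
end

section
/- Let T be a finite directed multigraph with edge coloring χ : E(T) → 𝒞 which is two-edge-connected, and let π = (π_s)_{s∈𝒮} be a family of partitions of V(T) with π_s ≥ ρ_s for every s ∈ 𝒮. Then Σ_{s∈𝒮} (#π_s − 1) + Σ_{c∈𝒞} #𝒮_c · (𝔣(T_{π,c})/2 − #V(T_{π,c})) ≤ 0. Moreover, equality holds if and only if GCC(T,π,s) is a tree for every s ∈ 𝒮, and in that case 𝔣(T_{π,c})/2 = #Comp(T_{π,c}) for every c ∈ 𝒞. -/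
open Filter MeasureTheory Matrix
open scoped BigOperators Classical

namespace GraphPaper

/-! ### Components of edge subsets -/

namespace Digr

variable {V E : Type*} (D : Digr V E)

/-- Connectedness using only the edges in `A`. -/
def reach (A : Set E) : Setoid V :=
  Relation.EqvGen.setoid (fun v w => ∃ e ∈ A, D.src e = v ∧ D.tgt e = w)

/-- The number of classes of `D.reach A`. -/
noncomputable def reachCard (A : Set E) : ℕ := Nat.card (Quotient (D.reach A))

variable {D} {A B X : Set E} {e : E}

theorem reach_edge (he : e ∈ A) : D.reach A (D.src e) (D.tgt e) :=
  Relation.EqvGen.rel _ _ ⟨e, he, rfl, rfl⟩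

theorem reach_le {r : Setoid V} (h : ∀ e ∈ A, r (D.src e) (D.tgt e)) : D.reach A ≤ r := by
  refine Setoid.eqvGen_le ?_
  rintro v w ⟨e, he, rfl, rfl⟩
  exact h e he

theorem reach_mono (h : A ⊆ B) : D.reach A ≤ D.reach B :=
  reach_le fun _ he => reach_edge (h he)

theorem compSetoid_eq_reach : D.compSetoid = D.reach Set.univ := by
  simp [compSetoid, reach, Relation.EqvGen.setoid]
  rfl

theorem erase_compSetoid_eq_reach : (D.erase e).compSetoid = D.reach {e}ᶜ := by
  refine le_antisymm (Setoid.eqvGen_le ?_) (reach_le fun f hf => ?_)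
  · rintro v w ⟨f, rfl, rfl⟩
    exact reach_edge f.2
  · exact Relation.EqvGen.rel _ _ ⟨⟨f, hf⟩, rfl, rfl⟩

theorem ncomp_eq_reachCard : D.ncomp = D.reachCard Set.univ := by
  rw [ncomp, Components, compSetoid_eq_reach, reachCard]

theorem tecSetoid_eq_reach : D.tecSetoid = D.reach {e | ¬ D.IsCutEdge e} := rfl

theorem reach_insert_of_reach (h : D.reach A (D.src e) (D.tgt e)) :
    D.reach (insert e A) = D.reach A := by
  refine le_antisymm (reach_le ?_) (reach_mono (Set.subset_insert _ _))
  rintro f (rfl | hf)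
  · exact h
  · exact reach_edge hf

theorem reachCard_of_not_reach [Finite V] (h : ¬ D.reach A (D.src e) (D.tgt e)) :
    D.reachCard A = D.reachCard (insert e A) + 1 := by
  set a : Quotient (D.reach A) := Quotient.mk _ (D.src e)
  set b : Quotient (D.reach A) := Quotient.mk _ (D.tgt e)
  have hab : a ≠ b := fun hab => h (Quotient.exact hab)
  let f : Quotient (D.reach A) → Quotient (D.reach A) := fun x => if x = a then b else x
  have hf : D.reach (insert e A) ≤ Setoid.ker (fun v => f (Quotient.mk _ v)) := by
    refine reach_le ?_
    rintro g (rfl | hg)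
    · change f a = f b
      simp [f]
    · exact congrArg f (Quotient.sound (reach_edge hg))
  let p : Quotient (D.reach A) → Quotient (D.reach (insert e A)) :=
    Quotient.map id (reach_mono (Set.subset_insert _ _))
  have hp : p a = p b := Quotient.sound (reach_edge (Set.mem_insert _ _))
  have hbij : Function.Bijective (fun x : {x // x ≠ a} => p x.1) := by
    constructor
    · rintro ⟨x, hx⟩ ⟨y, hy⟩ hxy
      induction x using Quotient.inductionOn with | _ v => ?_
      induction y using Quotient.inductionOn with | _ w => ?_
      have := hf (Quotient.exact hxy)
      simp only [Setoid.ker_def, f, if_neg hx, if_neg hy, id] at this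
      exact Subtype.ext this
    · intro y
      induction y using Quotient.inductionOn with | _ v => ?_
      by_cases hv : (Quotient.mk _ v : Quotient (D.reach A)) = a
      · refine ⟨⟨b, hab.symm⟩, ?_⟩
        change p b = p (Quotient.mk _ v)
        rw [hv, hp]
      · exact ⟨⟨_, hv⟩, rfl⟩
  have h1 := Nat.card_congr (Equiv.ofBijective _ hbij)
  have h2 := Set.ncard_add_ncard_compl ({a} : Set (Quotient (D.reach A)))
  rw [Set.ncard_singleton] at h2
  have h3 : Nat.card {x // x ≠ a} = ({a}ᶜ : Set (Quotient (D.reach A))).ncard := rfl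
  unfold reachCard
  omega

theorem reachCard_le_insert [Finite V] : D.reachCard A ≤ D.reachCard (insert e A) + 1 := by
  by_cases h : D.reach A (D.src e) (D.tgt e)
  · rw [reachCard, reachCard, reach_insert_of_reach h]
    omega
  · exact (reachCard_of_not_reach h).le

theorem insert_diff_insert (he : e ∈ A) (heX : e ∉ X) : insert e (A \ insert e X) = A \ X := by
  ext f
  by_cases hf : f = e
  · subst hf; simp [he, heX]
  · simp [hf]

theorem reachCard_diff_le [Finite V] [Finite E] (hX : X ⊆ A) :
    D.reachCard (A \ X) ≤ D.reachCard A + X.ncard := by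
  induction X, X.toFinite using Set.Finite.induction_on with
  | empty => simp
  | @insert e X heX _ ih =>
    have h1 := ih ((Set.subset_insert _ _).trans hX)
    have h2 := reachCard_le_insert (D := D) (A := A \ insert e X) (e := e)
    rw [insert_diff_insert (hX (Set.mem_insert _ _)) heX] at h2
    rw [Set.ncard_insert_of_notMem heX]
    omega

theorem reachCard_diff_eq [Finite V] [Finite E] (hX : X ⊆ A)
    (h : ∀ e ∈ X, ¬ D.reach (A \ {e}) (D.src e) (D.tgt e)) :
    D.reachCard (A \ X) = D.reachCard A + X.ncard := by
  induction X, X.toFinite using Set.Finite.induction_on with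
  | empty => simp
  | @insert e X heX _ ih =>
    have h1 := ih ((Set.subset_insert _ _).trans hX) fun f hf => h f (Set.mem_insert_of_mem _ hf)
    have h2 := reachCard_of_not_reach (D := D) (A := A \ insert e X) (e := e) fun hr =>
      h e (Set.mem_insert _ _) (reach_mono (Set.sdiff_subset_sdiff_right (by simp)) hr)
    rw [insert_diff_insert (hX (Set.mem_insert _ _)) heX] at h2
    rw [Set.ncard_insert_of_notMem heX]
    omega

theorem isCutEdge_iff [Finite V] :
    D.IsCutEdge e ↔ ¬ D.reach {e}ᶜ (D.src e) (D.tgt e) := by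
  have hins : insert e ({e}ᶜ : Set E) = Set.univ := by
    ext f; simp [em]
  rw [IsCutEdge, ncomp_eq_reachCard, ncomp, Components, erase_compSetoid_eq_reach, ← reachCard,
    ← hins]
  refine ⟨fun h hr => ?_, fun h => ?_⟩
  · rw [reachCard, reachCard, reach_insert_of_reach hr] at h
    exact h.false
  · rw [reachCard_of_not_reach h]
    omega

theorem reachCard_empty : D.reachCard ∅ = Nat.card V := by
  have h : D.reach ∅ = ⊥ := le_antisymm (reach_le (by simp)) bot_le
  rw [reachCard, h]
  exact (Nat.card_congr (Equiv.ofBijective _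
    ⟨fun _ _ hvw => Quotient.exact hvw, Quotient.mk_surjective⟩)).symm

theorem IsConnected.ncomp_eq_one (h : D.IsConnected) : D.ncomp = 1 := by
  obtain ⟨⟨v⟩, h⟩ := h
  rw [ncomp, Nat.card_eq_one_iff_exists]
  refine ⟨Quotient.mk _ v, fun y => ?_⟩
  induction y using Quotient.inductionOn with | _ w => exact Quotient.sound (h w v)

theorem IsConnected.isTree_iff [Finite V] [Finite E] (h : D.IsConnected) :
    D.IsTree ↔ Nat.card V = Nat.card E + 1 := by
  have hc := h.ncomp_eq_one
  rw [ncomp_eq_reachCard] at hc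
  refine ⟨fun ht => ?_, fun hcard => ⟨h, fun e => ?_⟩⟩
  · have := reachCard_diff_eq (D := D) (Set.subset_univ Set.univ) fun e _ => by
      rw [← Set.compl_eq_univ_sdiff]; exact isCutEdge_iff.1 (ht.2 e)
    rw [Set.sdiff_self, reachCard_empty, Set.ncard_univ] at this
    omega
  · rw [isCutEdge_iff]
    intro hr
    have hins : insert e ({e}ᶜ : Set E) = Set.univ := by
      ext f; simp [em]
    have h1 := reachCard_diff_le (D := D) (Set.Subset.refl ({e}ᶜ : Set E))
    have h2 := Set.ncard_add_ncard_compl ({e} : Set E)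
    have h3 : D.reachCard {e}ᶜ = 1 := by
      rw [← hc, ← hins, reachCard, reachCard, reach_insert_of_reach hr]
    rw [Set.sdiff_self, reachCard_empty] at h1
    rw [Set.ncard_singleton] at h2
    omega

theorem reachCard_not_isCutEdge [Finite V] [Finite E] :
    D.reachCard {e | ¬ D.IsCutEdge e} = D.ncomp + {e | D.IsCutEdge e}.ncard := by
  have := reachCard_diff_eq (D := D) (Set.subset_univ {e | D.IsCutEdge e}) fun e he => by
      rw [← Set.compl_eq_univ_sdiff]; exact isCutEdge_iff.1 he
  rwa [← Set.compl_eq_univ_sdiff, ← ncomp_eq_reachCard] at this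

theorem reach_not_isCutEdge_diff [Finite V] [Finite E] (he : ¬ D.IsCutEdge e) :
    D.reach ({e | ¬ D.IsCutEdge e} \ {e}) (D.src e) (D.tgt e) := by
  have hr : D.reach {e}ᶜ (D.src e) (D.tgt e) := by_contra fun h => he (isCutEdge_iff.2 h)
  have hins : insert e ({e}ᶜ : Set E) = Set.univ := by
    ext f; simp [em]
  have h0 : D.reachCard {e}ᶜ = D.ncomp := by
    rw [ncomp_eq_reachCard, ← hins, reachCard, reachCard, reach_insert_of_reach hr]
  have h1 := reachCard_diff_eq (D := D) (A := {e}ᶜ) (X := {e | D.IsCutEdge e})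
    (fun f hf hfe => he (by rwa [Set.mem_singleton_iff.1 hfe] at hf))
    (fun f hf h => isCutEdge_iff.1 hf (reach_mono (by intro g; simp) h))
  have hset : ({e}ᶜ : Set E) \ {e | D.IsCutEdge e} = {e | ¬ D.IsCutEdge e} \ {e} := by
    ext f; simp [and_comm]
  rw [hset, h0, ← reachCard_not_isCutEdge] at h1
  by_contra hn
  have h2 := reachCard_of_not_reach hn
  rw [Set.insert_sdiff_singleton, Set.insert_eq_of_mem (by exact he)] at h2
  omega

theorem eq_of_reach_of_isolated {v w : V} (hv : ∀ e ∈ A, D.src e ≠ v ∧ D.tgt e ≠ v)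
    (h : D.reach A v w) : v = w := by
  have : D.reach A ≤ Setoid.ker (fun x => x = v) :=
    reach_le fun e he => by simp [Setoid.ker_def, hv e he]
  have h' := this h
  simpa [Setoid.ker_def, eq_comm] using h'

/-- The degree of `v` in the subgraph with edge set `A`, loops counting twice. -/
noncomputable def degOn (D : Digr V E) (A : Set E) (v : V) : ℕ :=
  {e | e ∈ A ∧ D.src e = v}.ncard + {e | e ∈ A ∧ D.tgt e = v}.ncard

theorem sum_degOn [Fintype V] [Finite E] : ∑ v, D.degOn A v = 2 * A.ncard := by
  have key (f : E → V) : ∑ v, {e | e ∈ A ∧ f e = v}.ncard = A.ncard := by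
    have := Fintype.ofFinite E
    rw [Set.ncard_eq_toFinset_card', Finset.card_eq_sum_card_fiberwise (f := f) (t := Finset.univ)
      (fun _ _ => by simp)]
    refine Finset.sum_congr rfl fun v _ => ?_
    rw [Set.ncard_eq_toFinset_card']
    congr 1
    ext e
    simp
  simp only [degOn, Finset.sum_add_distrib, key]
  ring

theorem degOn_eq_zero_iff [Finite E] {v : V} :
    D.degOn A v = 0 ↔ ∀ e ∈ A, D.src e ≠ v ∧ D.tgt e ≠ v := by
  rw [degOn, Nat.add_eq_zero_iff, Set.ncard_eq_zero, Set.ncard_eq_zero,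
    Set.eq_empty_iff_forall_notMem, Set.eq_empty_iff_forall_notMem]
  simp only [Set.mem_ofPred_eq]
  grind

theorem degOn_not_isCutEdge_ne_one [Finite V] [Finite E] (v : V) :
    D.degOn {e | ¬ D.IsCutEdge e} v ≠ 1 := by
  intro h
  obtain ⟨e, he, hev, huniq, hloop⟩ : ∃ e, ¬ D.IsCutEdge e ∧ (D.src e = v ∨ D.tgt e = v) ∧
      (∀ f, ¬ D.IsCutEdge f → f ≠ e → D.src f ≠ v ∧ D.tgt f ≠ v) ∧ D.src e ≠ D.tgt e := by
    rcases Nat.add_eq_one_iff.1 h with ⟨h0, h1⟩ | ⟨h1, h0⟩ <;>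
    · rw [Set.ncard_eq_zero, Set.eq_empty_iff_forall_notMem] at h0
      obtain ⟨e, h1⟩ := Set.ncard_eq_one.1 h1
      have he := (Set.ext_iff.1 h1 e).2 rfl
      refine ⟨e, he.1, by simp [he.2], fun f hf hfe => ⟨fun hs => ?_, fun ht => ?_⟩, fun hl => ?_⟩
      · first | exact h0 f ⟨hf, hs⟩ | exact hfe ((Set.ext_iff.1 h1 f).1 ⟨hf, hs⟩)
      · first | exact h0 f ⟨hf, ht⟩ | exact hfe ((Set.ext_iff.1 h1 f).1 ⟨hf, ht⟩)
      · first | exact h0 e ⟨he.1, hl.trans he.2⟩ | exact h0 e ⟨he.1, hl.symm.trans he.2⟩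
  have hr := reach_not_isCutEdge_diff he
  have hiso : ∀ f ∈ {e | ¬ D.IsCutEdge e} \ {e}, D.src f ≠ v ∧ D.tgt f ≠ v :=
    fun f hf => huniq f hf.1 hf.2
  rcases hev with rfl | rfl
  · exact hloop (eq_of_reach_of_isolated hiso hr)
  · exact hloop (eq_of_reach_of_isolated hiso (Setoid.symm' _ hr)).symm

theorem ncard_isolated_le [Finite V] [Finite E] :
    {v | D.degOn A v = 0}.ncard + (if A.Nonempty then 1 else 0) ≤ D.reachCard A := by
  let f : {v | D.degOn A v = 0} → Quotient (D.reach A) := fun v => Quotient.mk _ v.1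
  have hinj : f.Injective := fun v w h =>
    Subtype.ext (eq_of_reach_of_isolated (degOn_eq_zero_iff.1 v.2) (Quotient.exact h))
  have hcard : (Set.range f).ncard = {v | D.degOn A v = 0}.ncard := 
    (Nat.card_congr (Equiv.ofInjective f hinj)).symm
  rw [← hcard]
  split_ifs with hA
  · obtain ⟨e, he⟩ := hA
    refine Nat.succ_le_of_lt (Set.ncard_lt_card fun h => ?_)
    obtain ⟨v, hv⟩ := Set.eq_univ_iff_forall.1 h (Quotient.mk _ (D.src e))
    have hiso := degOn_eq_zero_iff.1 v.2
    exact (hiso e he).1 (eq_of_reach_of_isolated hiso (Quotient.exact hv)).symm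
  · exact Set.ncard_le_card _

/-- The first Betti number of a multigraph dominates half of the excess degrees of its non-cut
edges, strictly as soon as there is a non-cut edge. -/
theorem sum_sub_two_add_le [Fintype V] [Finite E] {d : V → ℕ}
    (hd : ∀ v, d v ≤ {e | ¬ D.IsCutEdge e ∧ (D.src e = v ∨ D.tgt e = v)}.ncard) :
    ∑ v, (d v - 2) + 2 * Nat.card V + (if ∃ e, ¬ D.IsCutEdge e then 2 else 0) ≤
      2 * Nat.card E + 2 * D.ncomp := by
  set N : Set E := {e | ¬ D.IsCutEdge e} with hN
  have hdeg (v : V) : (d v - 2) + 2 ≤ D.degOn N v + (if D.degOn N v = 0 then 2 else 0) := by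
    have h1 := degOn_not_isCutEdge_ne_one (D := D) v
    have h2 : d v ≤ D.degOn N v := by
      refine (hd v).trans (le_trans (le_of_eq ?_) (Set.ncard_union_le _ _))
      congr 1
      ext e
      simp [hN, and_or_left]
    rw [← hN] at h1
    split_ifs <;> omega
  have hsum := Finset.sum_le_sum fun v (_ : v ∈ Finset.univ) => hdeg v
  have hiso : ∑ v, (if D.degOn N v = 0 then 2 else 0) = 2 * {v | D.degOn N v = 0}.ncard := by
    rw [Set.ncard_eq_toFinset_card', ← Finset.sum_filter, Finset.sum_const, smul_eq_mul, mul_comm]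
    congr 2
    ext v
    simp
  rw [Finset.sum_add_distrib, Finset.sum_add_distrib, sum_degOn, hiso, Finset.sum_const,
    smul_eq_mul, Finset.card_univ, ← Nat.card_eq_fintype_card] at hsum
  have h1 := ncard_isolated_le (D := D) (A := N)
  have h2 := reachCard_not_isCutEdge (D := D)
  have h3 := Set.ncard_add_ncard_compl {e | D.IsCutEdge e}
  have h4 : ({e | D.IsCutEdge e}ᶜ : Set E) = N := rfl
  have h5 : N.Nonempty ↔ ∃ e, ¬ D.IsCutEdge e := Iff.rfl
  rw [← hN] at h2
  rw [h4] at h3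
  simp only [h5] at h1
  split_ifs at h1 ⊢ <;> omega

theorem sum_tecDeg [Finite V] [Finite E] [Fintype (Quotient D.tecSetoid)] :
    ∑ b, D.tecDeg b = 2 * {e | D.IsCutEdge e}.ncard := by
  rw [← sum_degOn (D := D.quotient D.tecSetoid)]
  refine Finset.sum_congr rfl fun b _ => ?_
  rw [degOn, ← Set.ncard_union_eq]
  · refine (Nat.card_congr (Equiv.subtypeEquivRight fun e => ?_)).trans (Nat.card_coe_set_eq _)
    simp [quotient, and_or_left]
  · rw [Set.disjoint_left]
    rintro e ⟨he, hs⟩ ⟨-, ht⟩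
    have h : D.tecSetoid (D.src e) (D.tgt e) := Quotient.exact (hs.trans ht.symm)
    exact isCutEdge_iff.1 he
      (reach_mono (B := {e}ᶜ) (fun f (hf : ¬ D.IsCutEdge f) hfe => hf (by
        rwa [Set.mem_singleton_iff.1 hfe])) h)

theorem leafCount_eq [Finite V] [Finite E] [Fintype (Quotient D.tecSetoid)] :
    D.leafCount = 2 * D.ncomp + ∑ b, (D.tecDeg b - 2) := by
  have h (b : Quotient D.tecSetoid) :
      (if D.tecDeg b = 0 then 2 else if D.tecDeg b = 1 then 1 else 0) + D.tecDeg b =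
        (D.tecDeg b - 2) + 2 := by
    split_ifs <;> omega
  have hsum := Finset.sum_congr rfl fun b (_ : b ∈ Finset.univ) => h b
  rw [Finset.sum_add_distrib, Finset.sum_add_distrib, sum_tecDeg, Finset.sum_const, smul_eq_mul,
    Finset.card_univ, ← Nat.card_eq_fintype_card, ← finsum_eq_sum_of_fintype, ← leafCount] at hsum
  have h2 := reachCard_not_isCutEdge (D := D)
  rw [reachCard, ← tecSetoid_eq_reach] at h2
  omega

end Digr

/-! ### The graph of colored components with its forests expanded -/

section Colored

variable {V E S C : Type*} (D : Digr V E) (χ : E → C) (rel : S → C → Prop) (π : S → Setoid V)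
  (s : S)

/-- The graph `GCC(T,π,s)` in which each component of `T_{π,c}` is replaced by its tree of
two-edge-connected components. -/
def expandedGCC :
    Digr (Quotient (π s) ⊕ (Σ c : {c : C // rel s c}, Quotient (Tpc D χ rel π c.1).tecSetoid))
      (GCCEdge rel π s ⊕
        (Σ c : {c : C // rel s c}, {e : {e : E // χ e = c.1} // (Tpc D χ rel π c.1).IsCutEdge e}))
    where
  src := Sum.elim (fun p => Sum.inr ⟨p.1, Quotient.mk _ p.2⟩)
    (fun q => Sum.inr ⟨q.1, Quotient.mk _ ((Tpc D χ rel π q.1.1).src q.2.1)⟩)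
  tgt := Sum.elim (fun p => Sum.inl (hmap rel π p.1.2 p.2))
    (fun q => Sum.inr ⟨q.1, Quotient.mk _ ((Tpc D χ rel π q.1.1).tgt q.2.1)⟩)

variable {D χ rel π s}

theorem expandedGCC_reach_inl_inr
    {A : Set (GCCEdge rel π s ⊕ (Σ c : {c : C // rel s c},
      {e : {e : E // χ e = c.1} // (Tpc D χ rel π c.1).IsCutEdge e}))}
    (hA : ∀ p, Sum.inl p ∈ A) (c : {c : C // rel s c}) (v : V) :
    (expandedGCC D χ rel π s).reach A (Sum.inl (Quotient.mk _ v))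
      (Sum.inr ⟨c, Quotient.mk _ (Quotient.mk _ v)⟩) :=
  Setoid.symm' _ (Digr.reach_edge (D := expandedGCC D χ rel π s) (hA ⟨c, Quotient.mk _ v⟩))

theorem expandedGCC_reach
    (hρ : rhoSetoid D χ rel s ≤ π s) {B : Set E} (hB : ∀ v w, D.reach B v w)
    {A : Set (GCCEdge rel π s ⊕ (Σ c : {c : C // rel s c},
      {e : {e : E // χ e = c.1} // (Tpc D χ rel π c.1).IsCutEdge e}))}
    (hA : ∀ p, Sum.inl p ∈ A) (hAB : ∀ q, q.2.1.1 ∈ B → Sum.inr q ∈ A) (x y) :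
    (expandedGCC D χ rel π s).reach A x y := by
  set r := (expandedGCC D χ rel π s).reach A
  have hle : D.reach B ≤ r.comap (fun v => Sum.inl (Quotient.mk _ v)) := by
    refine Digr.reach_le fun e he => ?_
    rw [Setoid.comap_rel]
    by_cases hc : rel s (χ e)
    · refine r.trans' (expandedGCC_reach_inl_inr hA ⟨χ e, hc⟩ _)
        (r.trans' ?_ (r.symm' (expandedGCC_reach_inl_inr hA ⟨χ e, hc⟩ _)))
      by_cases hcut : (Tpc D χ rel π (χ e)).IsCutEdge ⟨e, rfl⟩
      · exact Digr.reach_edge (D := expandedGCC D χ rel π s)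
          (hAB ⟨⟨χ e, hc⟩, ⟨⟨e, rfl⟩, hcut⟩⟩ he)
      · have : (Tpc D χ rel π (χ e)).tecSetoid
            (Quotient.mk _ (D.src e)) (Quotient.mk _ (D.tgt e)) :=
          Relation.EqvGen.rel _ _ ⟨⟨e, rfl⟩, hcut, rfl, rfl⟩
        rw [Quotient.sound this]
    · have : rhoSetoid D χ rel s (D.src e) (D.tgt e) := Relation.EqvGen.rel _ _ ⟨e, hc, rfl, rfl⟩
      rw [Quotient.sound (hρ this)]
  have hx (x) : ∃ v : V, r x (Sum.inl (Quotient.mk _ v)) := by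
    rcases x with q | ⟨c, q⟩
    · induction q using Quotient.inductionOn with | _ v => exact ⟨v, r.refl' _⟩
    · induction q using Quotient.inductionOn with | _ q => ?_
      induction q using Quotient.inductionOn with | _ v => ?_
      exact ⟨v, r.symm' (expandedGCC_reach_inl_inr hA c v)⟩
  obtain ⟨v, hv⟩ := hx x
  obtain ⟨w, hw⟩ := hx y
  exact r.trans' hv (r.trans' (hle (hB v w)) (r.symm' hw))

theorem expandedGCC_isConnected (hρ : rhoSetoid D χ rel s ≤ π s) (hD : D.IsConnected) :
    (expandedGCC D χ rel π s).IsConnected := by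
  obtain ⟨⟨v⟩, hD⟩ := hD
  rw [Digr.compSetoid_eq_reach] at hD
  refine ⟨⟨Sum.inl (Quotient.mk _ v)⟩, ?_⟩
  rw [Digr.compSetoid_eq_reach]
  exact expandedGCC_reach hρ hD (fun _ => Set.mem_univ _) fun _ _ => Set.mem_univ _

theorem not_isCutEdge_expandedGCC_inr [Finite V] [Finite E] [Finite C]
    (hρ : rhoSetoid D χ rel s ≤ π s) (hD : D.IsTwoEdgeConnected) (q) :
    ¬ (expandedGCC D χ rel π s).IsCutEdge (Sum.inr q) := by
  rw [Digr.isCutEdge_iff, not_not]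
  refine expandedGCC_reach (B := {q.2.1.1}ᶜ) hρ ?_ (fun p => by simp) ?_ _ _
  · have h1 : D.reach {q.2.1.1}ᶜ (D.src q.2.1.1) (D.tgt q.2.1.1) :=
      by_contra fun h => hD.2 _ (Digr.isCutEdge_iff.2 h)
    have hins : insert q.2.1.1 ({q.2.1.1}ᶜ : Set E) = Set.univ := by
      ext f; simp [em]
    rw [← Digr.reach_insert_of_reach h1, hins, ← Digr.compSetoid_eq_reach]
    exact hD.1.2
  · intro q' hq' h
    rw [Set.mem_singleton_iff] at h
    exact hq' (by rw [Sum.inr_injective h]; rfl)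

theorem GCC_isConnected (hρ : rhoSetoid D χ rel s ≤ π s) (hD : D.IsConnected) :
    (GCC D χ rel π s).IsConnected := by
  have hle (c : C) : (Tpc D χ rel π c).tecSetoid ≤ (Tpc D χ rel π c).compSetoid := by
    rw [Digr.compSetoid_eq_reach]
    exact Digr.reach_mono (Set.subset_univ _)
  let f : Quotient (π s) ⊕ (Σ c : {c : C // rel s c}, Quotient (Tpc D χ rel π c.1).tecSetoid) →
      GCCVert D χ rel π s :=
    Sum.map id (Sigma.map id fun c => Quotient.map id (hle c.1))
  have hf : f.Surjective := by
    rintro (q | ⟨c, q⟩)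
    · exact ⟨Sum.inl q, rfl⟩
    · induction q using Quotient.inductionOn with | _ q => ?_
      exact ⟨Sum.inr ⟨c, Quotient.mk _ q⟩, rfl⟩
  have hcomap : (expandedGCC D χ rel π s).reach Set.univ ≤
      (GCC D χ rel π s).compSetoid.comap f := by
    refine Digr.reach_le ?_
    rintro (p | q) -
    · exact Relation.EqvGen.rel _ _ ⟨p, rfl, rfl⟩
    · rw [Setoid.comap_rel]
      have h : f ((expandedGCC D χ rel π s).src (Sum.inr q)) =
          f ((expandedGCC D χ rel π s).tgt (Sum.inr q)) := by
        have h' : (Tpc D χ rel π q.1.1).compSetoid ((Tpc D χ rel π q.1.1).src q.2.1)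
            ((Tpc D χ rel π q.1.1).tgt q.2.1) := Relation.EqvGen.rel _ _ ⟨q.2.1, rfl, rfl⟩
        exact congrArg (fun y => (Sum.inr ⟨q.1, y⟩ : GCCVert D χ rel π s)) (Quotient.sound h')
      rw [h]
  obtain ⟨⟨x⟩, hconn⟩ := expandedGCC_isConnected hρ hD
  rw [Digr.compSetoid_eq_reach] at hconn
  refine ⟨⟨f x⟩, fun v w => ?_⟩
  obtain ⟨a, rfl⟩ := hf v
  obtain ⟨b, rfl⟩ := hf w
  exact hcomap (hconn a b)

instance [Finite V] : Finite (Digr.Components D) := inferInstanceAs (Finite (Quotient _))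

instance [Finite V] [Finite C] : Finite (GCCVert D χ rel π s) :=
  inferInstanceAs (Finite (_ ⊕ _))

instance [Finite V] [Finite C] : Finite (GCCEdge rel π s) := inferInstanceAs (Finite (Sigma _))

theorem card_GCCVert [Finite V] [Fintype C] :
    Nat.card (GCCVert D χ rel π s) =
      Nat.card (Quotient (π s)) + ∑ c : {c : C // rel s c}, (Tpc D χ rel π c.1).ncomp := by
  rw [GCCVert, Nat.card_sum, Nat.card_sigma]
  rfl

theorem card_GCCEdge [Finite V] [Fintype C] :
    Nat.card (GCCEdge rel π s) =
      ∑ c : {c : C // rel s c}, Nat.card (Quotient (omegaSetoid rel π c.1)) := by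
  rw [GCCEdge, Nat.card_sigma]

/-- The leaf-count inequality for a single string `s`, together with its equality case. -/
theorem leafCount_le_of_string [Finite V] [Finite E] [Fintype C]
    (hρ : rhoSetoid D χ rel s ≤ π s) (hD : D.IsTwoEdgeConnected) :
    Nat.card (Quotient (π s)) * 2 + ∑ c : {c : C // rel s c}, (Tpc D χ rel π c.1).leafCount ≤
        2 + 2 * Nat.card (GCCEdge rel π s) ∧
      (Nat.card (Quotient (π s)) * 2 + ∑ c : {c : C // rel s c}, (Tpc D χ rel π c.1).leafCount =
        2 + 2 * Nat.card (GCCEdge rel π s) ↔ (GCC D χ rel π s).IsTree) ∧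
      ((GCC D χ rel π s).IsTree → ∀ c, rel s c →
        (Tpc D χ rel π c).leafCount = 2 * (Tpc D χ rel π c).ncomp) := by
  have := Fintype.ofFinite V
  set H := expandedGCC D χ rel π s
  have hHc : H.IsConnected := expandedGCC_isConnected hρ hD.1
  have hcut (q) : ¬ H.IsCutEdge (Sum.inr q) := not_isCutEdge_expandedGCC_inr hρ hD q
  let d : Quotient (π s) ⊕
      (Σ c : {c : C // rel s c}, Quotient (Tpc D χ rel π c.1).tecSetoid) → ℕ :=
    Sum.elim (fun _ => 0) (fun b => (Tpc D χ rel π b.1.1).tecDeg b.2)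
  have hd (x) : d x ≤ {e | ¬ H.IsCutEdge e ∧ (H.src e = x ∨ H.tgt e = x)}.ncard := by
    rcases x with q | ⟨c, b⟩
    · exact Nat.zero_le _
    · have hinr (a b : Quotient (Tpc D χ rel π c.1).tecSetoid) (h : a = b) :
          (Sum.inr ⟨c, a⟩ : Quotient (π s) ⊕ (Σ c : {c : C // rel s c},
            Quotient (Tpc D χ rel π c.1).tecSetoid)) = Sum.inr ⟨c, b⟩ := by rw [h]
      rw [← Nat.card_coe_set_eq]
      refine Nat.card_le_card_of_injective (fun e => ⟨Sum.inr ⟨c, ⟨e.1, e.2.1⟩⟩, hcut _, ?_⟩) ?_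
      · rcases e.2.2 with h | h
        · exact Or.inl (hinr _ _ h)
        · exact Or.inr (hinr _ _ h)
      · intro e f hef
        simpa [Subtype.ext_iff] using hef
  have key := Digr.sum_sub_two_add_le hd
  have hleaf := Finset.sum_congr rfl fun (c : {c : C // rel s c}) (_ : c ∈ Finset.univ) =>
    Digr.leafCount_eq (D := Tpc D χ rel π c.1)
  have hforest := Finset.sum_congr rfl fun (c : {c : C // rel s c}) (_ : c ∈ Finset.univ) =>
    Digr.reachCard_not_isCutEdge (D := Tpc D χ rel π c.1)
  have htree := hHc.isTree_iff
  have hgtree := (GCC_isConnected hρ hD.1).isTree_iff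
  rw [card_GCCVert] at hgtree
  have hsum : ∑ x, (d x - 2) =
      ∑ c : {c : C // rel s c}, ∑ b, ((Tpc D χ rel π c.1).tecDeg b - 2) := by
    rw [Fintype.sum_sum_type, Fintype.sum_sigma]
    simp [d]
  have hV := Nat.card_sum (α := Quotient (π s))
    (β := Σ c : {c : C // rel s c}, Quotient (Tpc D χ rel π c.1).tecSetoid)
  have hE := Nat.card_sum (α := GCCEdge rel π s) (β := Σ c : {c : C // rel s c},
    {e : {e : E // χ e = c.1} // (Tpc D χ rel π c.1).IsCutEdge e})
  rw [Nat.card_sigma] at hV hE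
  rw [hHc.ncomp_eq_one, hsum] at key
  rw [Finset.sum_add_distrib] at hforest hleaf
  rw [← Finset.mul_sum] at hleaf
  have hf1 : ∑ c : {c : C // rel s c}, (Tpc D χ rel π c.1).reachCard
      {e | ¬ (Tpc D χ rel π c.1).IsCutEdge e} =
      ∑ c : {c : C // rel s c}, Nat.card (Quotient (Tpc D χ rel π c.1).tecSetoid) := rfl
  have hf2 : ∑ c : {c : C // rel s c}, {e | (Tpc D χ rel π c.1).IsCutEdge e}.ncard =
      ∑ c : {c : C // rel s c}, Nat.card {e : {e : E // χ e = c.1} //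
        (Tpc D χ rel π c.1).IsCutEdge e} := rfl
  rw [hf1, hf2] at hforest
  have hzero (ht : (GCC D χ rel π s).IsTree) (c : C) (hc : rel s c) (b) :
      (Tpc D χ rel π c).tecDeg b = 0 := by
    have hHt : H.IsTree := htree.2 (by have := hgtree.1 ht; omega)
    rw [Digr.tecDeg, Nat.card_eq_zero]
    exact Or.inl ⟨fun e => hcut ⟨⟨c, hc⟩, ⟨e.1, e.2.1⟩⟩ (hHt.2 _)⟩
  refine ⟨?_, ⟨fun heq => ?_, fun ht => ?_⟩, fun ht c hc => ?_⟩
  · split_ifs at key <;> omega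
  · have hall : ∀ e, H.IsCutEdge e := by
      by_contra! hex
      rw [if_pos hex] at key
      omega
    have := htree.1 ⟨hHc, hall⟩
    exact hgtree.2 (by omega)
  · have h0 : ∑ c : {c : C // rel s c}, ∑ b, ((Tpc D χ rel π c.1).tecDeg b - 2) = 0 :=
      Finset.sum_eq_zero fun c _ => Finset.sum_eq_zero fun b _ => by
        simp [hzero ht c.1 c.2]
    have := hgtree.1 ht
    omega
  · rw [Digr.leafCount_eq, Finset.sum_eq_zero fun b _ => by simp [hzero ht c hc], add_zero]

/-- The left-hand side of the leaf-count inequality, as a sum over strings. -/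
theorem leafCount_sum_eq [Finite V] [Fintype C] [Fintype S] :
    ((∑ s : S, ((Nat.card (Quotient (π s)) : ℝ) - 1)) +
        ∑ c : C, (Nat.card {s : S // rel s c} : ℝ) *
          (((Tpc D χ rel π c).leafCount : ℝ) / 2 -
            (Nat.card (Quotient (omegaSetoid rel π c)) : ℝ))) =
      ∑ s : S, ((Nat.card (Quotient (π s)) : ℝ) - 1 +
        ((∑ c : {c : C // rel s c}, (Tpc D χ rel π c.1).leafCount : ℕ) / 2 -
          Nat.card (GCCEdge rel π s))) := by
  rw [Finset.sum_add_distrib]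
  congr 1
  have h1 (s : S) : (((∑ c : {c : C // rel s c}, (Tpc D χ rel π c.1).leafCount : ℕ) : ℝ) / 2 -
      Nat.card (GCCEdge rel π s)) = ∑ c : C, if rel s c then
        (((Tpc D χ rel π c).leafCount : ℝ) / 2 -
            (Nat.card (Quotient (omegaSetoid rel π c)) : ℝ)) else 0 := by
    rw [card_GCCEdge, ← Finset.sum_filter, Finset.sum_subtype (p := rel s) _ (by simp)]
    push_cast
    rw [Finset.sum_sub_distrib, Finset.sum_div]
  simp only [h1]
  rw [Finset.sum_comm]
  refine Finset.sum_congr rfl fun c _ => ?_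
  rw [← Finset.sum_filter, Finset.sum_const, nsmul_eq_mul, Nat.card_eq_fintype_card,
    Fintype.card_subtype]

end Colored

/-- **Lemma (leaf-count inequality and its equality case).** -/
theorem statement12 {C S V E : Type} [Fintype C] [Fintype S] [Fintype V] [Fintype E]
    (rel : S → C → Prop) (hne : ∀ c : C, ∃ s : S, rel s c)
    (D : Digr V E) (χ : E → C) (h2ec : D.IsTwoEdgeConnected)
    (π : S → Setoid V) (hρ : ∀ s : S, rhoSetoid D χ rel s ≤ π s) :
    ((∑ s : S, ((Nat.card (Quotient (π s)) : ℝ) - 1)) +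
        ∑ c : C, (Nat.card {s : S // rel s c} : ℝ) *
          (((Tpc D χ rel π c).leafCount : ℝ) / 2 -
            (Nat.card (Quotient (omegaSetoid rel π c)) : ℝ)) ≤ 0)
    ∧ (((∑ s : S, ((Nat.card (Quotient (π s)) : ℝ) - 1)) +
          ∑ c : C, (Nat.card {s : S // rel s c} : ℝ) *
            (((Tpc D χ rel π c).leafCount : ℝ) / 2 -
              (Nat.card (Quotient (omegaSetoid rel π c)) : ℝ)) = 0)
        ↔ ∀ s : S, (GCC D χ rel π s).IsTree)
    ∧ ((∀ s : S, (GCC D χ rel π s).IsTree) →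
        ∀ c : C, ((Tpc D χ rel π c).leafCount : ℝ) / 2
          = ((Tpc D χ rel π c).ncomp : ℝ)) := by
  have key (s : S) := leafCount_le_of_string (hρ s) h2ec
  have hterm (s : S) : (Nat.card (Quotient (π s)) : ℝ) - 1 +
      ((∑ c : {c : C // rel s c}, (Tpc D χ rel π c.1).leafCount : ℕ) / 2 -
        Nat.card (GCCEdge rel π s)) ≤ 0 := by
    have := (Nat.cast_le (α := ℝ)).2 (key s).1
    push_cast at this ⊢
    linarith
  rw [leafCount_sum_eq]
  refine ⟨Finset.sum_nonpos fun s _ => hterm s, ?_, fun ht c => ?_⟩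
  · rw [Finset.sum_eq_zero_iff_of_nonpos fun s _ => hterm s]
    refine forall_congr' fun s => ?_
    rw [← (key s).2.1, ← Nat.cast_inj (R := ℝ)]
    push_cast
    constructor
    · intro h
      linarith [h (Finset.mem_univ s)]
    · intro h _
      linarith
  · obtain ⟨s, hs⟩ := hne c
    rw [(key s).2.2 (ht s) c hs]
    push_cast
    ring

end GraphPaper
end
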